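/- Let U_s be an admissible shear flow satisfying the weighted decay conditions for a weight ω, and let η > 0. There exists K > 0 such that for every integer k ≥ K and every μ ∈ ℂ with Im μ ≥ η, the problem (μ − U_s)φ' + U_s' φ − (i/k) φ''' = F with φ(0) = 0, φ'(0) = 1, and φ'(y) → 0 as y → ∞ has a unique solution φ; moreover for each fixed such k, the map μ ↦ φ is analytic. -/

import Mathlib

open MeasureTheory Filter Set

noncomputable section

/-- The source term `F(y) = 1 - U(y) + y U'(y)` of the eigenmode ODE. -/
def srcF (U : ℝ → ℝ) (y : ℝ) : ℝ := 1 - U y + y * deriv U y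

/-- The displacement thickness `Δ_s = ∫₀^∞ (1 - U)`. -/
def deltaS (U : ℝ → ℝ) : ℝ := ∫ y in Ioi (0:ℝ), (1 - U y)

/-- An admissible shear flow: smooth, monotone, `U(0) = 0`, `U → 1`,
`U''(0) ≠ 0`, finitely many inflexion points, and the decay conditions of the paper. -/
structure AdmissibleShearFlow (U : ℝ → ℝ) : Prop where
  smooth : ContDiff ℝ (⊤ : ℕ∞) U
  mem_Ico : ∀ y, 0 ≤ y → U y ∈ Ico (0:ℝ) 1
  zero_val : U 0 = 0
  deriv_pos : ∀ y, 0 ≤ y → 0 < deriv U y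
  tendsto_one : Tendsto U atTop (nhds 1)
  snd_deriv_zero_ne : iteratedDeriv 2 U 0 ≠ 0
  finite_inflexions : {y : ℝ | 0 < y ∧ iteratedDeriv 2 U y = 0}.Finite
  integrable_defect : IntegrableOn (fun y => 1 - U y) (Ioi (0:ℝ))
  derivs_bounded : ∀ j : ℕ, 1 ≤ j → j ≤ 3 →
    ∃ M : ℝ, ∀ y, 0 ≤ y → |iteratedDeriv j U y| ≤ M
  decay_ratio₁ : Tendsto (fun y => (1 - U y) ^ 2 / deriv U y) atTop (nhds 0)
  decay_ratio₂ : Tendsto (fun y => y * (1 - U y)) atTop (nhds 0)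
  decay_ratio₃ : IntegrableOn
    (fun y => (1 - U y) ^ 2 * iteratedDeriv 2 U y / (deriv U y) ^ 2) (Ioi (0:ℝ))
  kappa_decay : ∃ κ : ℝ, 0 < κ ∧ κ < 1/2 ∧ ∃ yκ > (0:ℝ), ∃ cκ > (0:ℝ),
    ∀ y, yκ ≤ y →
      (1 - U y) ^ ((2:ℝ) - κ) * iteratedDeriv 2 U y ≤ -cκ * (deriv U y) ^ 3

/-- `φ` is a smooth solution of the eigenmode problem
`(μ - U_s)φ' + U_s'φ - (i/k)φ''' = F`, `φ(0) = 0`, `φ'(0) = 1`, `φ' → 0`, `φ → L`. -/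
def IsEigSolution (U : ℝ → ℝ) (μ : ℂ) (k : ℝ) (L : ℂ) (φ : ℝ → ℂ) : Prop :=
  ContDiff ℝ (⊤ : ℕ∞) φ ∧
  (∀ y, 0 ≤ y →
    (μ - (U y : ℂ)) * deriv φ y + ((deriv U y : ℝ) : ℂ) * φ y
      - Complex.I / (k : ℂ) * iteratedDeriv 3 φ y = (srcF U y : ℂ)) ∧
  φ 0 = 0 ∧ deriv φ 0 = 1 ∧
  Tendsto (deriv φ) atTop (nhds 0) ∧
  Tendsto φ atTop (nhds L)

/-- Same problem without the prescribed limit at infinity. -/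
def IsBLSolution (U : ℝ → ℝ) (μ : ℂ) (k : ℝ) (φ : ℝ → ℂ) : Prop :=
  ContDiff ℝ (⊤ : ℕ∞) φ ∧
  (∀ y, 0 ≤ y →
    (μ - (U y : ℂ)) * deriv φ y + ((deriv U y : ℝ) : ℂ) * φ y
      - Complex.I / (k : ℂ) * iteratedDeriv 3 φ y = (srcF U y : ℂ)) ∧
  φ 0 = 0 ∧ deriv φ 0 = 1 ∧ Tendsto (deriv φ) atTop (nhds 0)

/-- Cauchy principal value `PV ∫₀¹ h(u)/(u - a) du`. -/
def pvIntegral (h : ℝ → ℝ) (a : ℝ) : ℝ :=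
  limUnder (nhdsWithin (0:ℝ) (Ioi 0))
    (fun ε => ∫ u in Ioo (0:ℝ) 1 \ Ioo (a - ε) (a + ε), h u / (u - a))

/-- Inverse of the shear flow on `[0, ∞)`. -/
def shearInv (U : ℝ → ℝ) (u : ℝ) : ℝ := Function.invFunOn U (Ici 0) u

/-- `g(u) = (1-u)² U''(U⁻¹(u)) / (U'(U⁻¹(u)))³`. -/
def gfun (U : ℝ → ℝ) (u : ℝ) : ℝ :=
  (1 - u) ^ 2 * iteratedDeriv 2 U (shearInv U u) / (deriv U (shearInv U u)) ^ 3

/-- `G(a) = 1/(a U'(0)) + PV ∫₀¹ g(u)/(u-a) du + iπ g(a)`. -/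
def Gfun (U : ℝ → ℝ) (a : ℝ) : ℂ :=
  ((1 / (a * deriv U 0) + pvIntegral (gfun U) a : ℝ) : ℂ)
    + Complex.I * ((Real.pi * gfun U a : ℝ) : ℂ)

/-- Crossing abscissa `χ(y) = Re G(U(y))`. -/
def chiAbscissa (U : ℝ → ℝ) (y : ℝ) : ℝ := (Gfun U (U y)).re

/-- `ξ(γ)`: number of zeros of `U''` in `(0,∞)` with `χ(yᵢ) = γ`. -/
def xiEq (U : ℝ → ℝ) (γ : ℝ) : ℕ :=
  {y : ℝ | 0 < y ∧ iteratedDeriv 2 U y = 0 ∧ chiAbscissa U y = γ}.ncard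

/-- `ξ₊(γ)`: zeros of `U''` with `χ(yᵢ) < γ`, `U'' < 0` on the left and `U'' > 0`
on the right. -/
def xiPlus (U : ℝ → ℝ) (γ : ℝ) : ℕ :=
  {y : ℝ | 0 < y ∧ iteratedDeriv 2 U y = 0 ∧ chiAbscissa U y < γ ∧
    ∃ δ > (0:ℝ), (∀ z ∈ Ioo (y - δ) y, iteratedDeriv 2 U z < 0) ∧
      (∀ z ∈ Ioo y (y + δ), 0 < iteratedDeriv 2 U z)}.ncard

/-- `ξ₋(γ)`: zeros of `U''` with `χ(yᵢ) < γ`, `U'' > 0` on the left and `U'' < 0`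
on the right. -/
def xiMinus (U : ℝ → ℝ) (γ : ℝ) : ℕ :=
  {y : ℝ | 0 < y ∧ iteratedDeriv 2 U y = 0 ∧ chiAbscissa U y < γ ∧
    ∃ δ > (0:ℝ), (∀ z ∈ Ioo (y - δ) y, 0 < iteratedDeriv 2 U z) ∧
      (∀ z ∈ Ioo y (y + δ), iteratedDeriv 2 U z < 0)}.ncard

/-- `Φ_inv(μ) = (μ - 1) ∫₀^∞ F(y)/(μ - U(y))² dy`. -/
def PhiInv (U : ℝ → ℝ) (μ : ℂ) : ℂ :=
  (μ - 1) * ∫ y in Ioi (0:ℝ), (srcF U y : ℂ) / (μ - (U y : ℂ)) ^ 2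

/-- A weight function `ω ≥ 1` with `C_ω < ∞`. -/
structure WeightFn (ω : ℝ → ℝ) : Prop where
  pos : ∀ y, 0 ≤ y → 0 < ω y
  contDiff : ContDiff ℝ 1 ω
  one_le : ∀ y, 0 ≤ y → 1 ≤ ω y
  integrable_inv : IntegrableOn (fun y => 1 / ω y) (Ioi (0:ℝ))
  deriv_ratio_bdd : ∃ M : ℝ, ∀ y, 0 ≤ y → |deriv ω y / ω y| ≤ M
  log_ratio_bdd : ∃ M : ℝ, ∀ y, 0 ≤ y → Real.log (ω y) / (1 + y) ≤ M

/-- Weighted decay conditions: `(1-U_s) ∈ L²(ω)` and `(1+y)U_s^{(j)} ∈ L²(ω)`, `j = 1,2,3`. -/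
def WeightedDecay (U ω : ℝ → ℝ) : Prop :=
  IntegrableOn (fun y => (1 - U y) ^ 2 * ω y) (Ioi (0:ℝ)) ∧
  ∀ j : ℕ, 1 ≤ j → j ≤ 3 →
    IntegrableOn (fun y => ((1 + y) * iteratedDeriv j U y) ^ 2 * ω y) (Ioi (0:ℝ))

/-- Membership in the weighted space `L²(ω)`. -/
def MemL2w (ω : ℝ → ℝ) (f : ℝ → ℂ) : Prop :=
  IntegrableOn (fun y => ‖f y‖ ^ 2 * ω y) (Ioi (0:ℝ))

/-- The `L²(ω)` norm. -/
def wNorm (ω : ℝ → ℝ) (f : ℝ → ℂ) : ℝ :=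
  Real.sqrt (∫ y in Ioi (0:ℝ), ‖f y‖ ^ 2 * ω y)

/-- `φ` solves the homogeneous-boundary-conditions resolvent problem with forcing `f`. -/
def SolvesHom (U : ℝ → ℝ) (μ : ℂ) (k : ℝ) (f φ : ℝ → ℂ) : Prop :=
  ContDiff ℝ 2 φ ∧
  (∀ᵐ y ∂(volume.restrict (Ioi (0:ℝ))),
    (μ - (U y : ℂ)) * deriv φ y + ((deriv U y : ℝ) : ℂ) * φ y
      - Complex.I / (k : ℂ) * iteratedDeriv 3 φ y = f y) ∧
  φ 0 = 0 ∧ deriv φ 0 = 0 ∧ Tendsto (deriv φ) atTop (nhds 0)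

/-- Parameterization on `[0,1]` of the contour `C_η`: the segment from `iη` to `1 + iη`
followed by the upper half-circle of radius `1/2` centered at `1/2 + iη`. -/
def Ceta (η : ℝ) (t : ℝ) : ℂ :=
  if t ≤ 1/2 then ((2*t : ℝ) : ℂ) + (η : ℂ) * Complex.I
  else (1/2 : ℂ) + (η : ℂ) * Complex.I
    + (1/2 : ℂ) * Complex.exp (((Real.pi * (2*t - 1) : ℝ)) * Complex.I)

/-- Winding number `(1/2πi) ∮ dz/(z - p)` of a closed curve parameterized on `[0,1]`. -/
def windingNumber (c : ℝ → ℂ) (p : ℂ) : ℂ :=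
  (((2 * Real.pi : ℝ) : ℂ) * Complex.I)⁻¹ * ∫ t in (0:ℝ)..1, deriv c t / (c t - p)

/-- `q_μ(x) = |μ - x|⁴ - (2μ - 1 - x)(μ̄ - x)²`. -/
def qmu (μ : ℂ) (x : ℝ) : ℂ :=
  ((‖μ - (x:ℂ)‖ ^ 4 : ℝ) : ℂ) - (2*μ - 1 - (x:ℂ)) * ((starRingEnd ℂ) μ - (x:ℂ))^2

/-- `f(α) = -2iΔ_s/α + 1/√α`, principal square root (positive real part for `Re α > 0`). -/
def fIBL (Δ : ℝ) (α : ℂ) : ℂ := (-2 * Complex.I * (Δ:ℂ)) / α + 1 / (α ^ (1/2 : ℂ))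


/-- Vitali-type lemma: bounded pointwise limits of holomorphic functions are holomorphic. -/
lemma differentiableAt_of_bdd_limit {f : ℕ → ℂ → ℂ} {g : ℂ → ℂ} {c : ℂ} {R C : ℝ} (hR : 0 < R)
    (hf : ∀ n, DifferentiableOn ℂ (f n) (Metric.closedBall c R))
    (hb : ∀ n, ∀ z ∈ Metric.closedBall c R, ‖f n z‖ ≤ C)
    (hg : ∀ z ∈ Metric.closedBall c R, Tendsto (fun n => f n z) atTop (nhds (g z))) :
    DifferentiableAt ℂ g c := by
  have hmem : ∀ θ, circleMap c R θ ∈ Metric.closedBall c R := fun θ =>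
    circleMap_mem_closedBall c hR.le θ
  have hcont : ∀ n, Continuous (fun θ => f n (circleMap c R θ)) := fun n =>
    (hf n).continuousOn.comp_continuous (continuous_circleMap c R) hmem
  have hgb : ∀ z ∈ Metric.closedBall c R, ‖g z‖ ≤ C := fun z hz =>
    le_of_tendsto' (hg z hz).norm fun n => hb n z hz
  have hgm : Measurable (fun θ => g (circleMap c R θ)) :=
    measurable_of_tendsto_metrizable (fun n => (hcont n).measurable)
      (tendsto_pi_nhds.2 fun θ => hg _ (hmem θ))
  have hgi : CircleIntegrable g c R := by
    unfold CircleIntegrable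
    refine (intervalIntegrable_const (c := C)).mono_fun hgm.aestronglyMeasurable ?_
    refine Eventually.of_forall fun θ => ?_
    exact (hgb _ (hmem θ)).trans (le_abs_self C)
  lift R to NNReal using hR.le
  have hps := hasFPowerSeriesOn_cauchy_integral hgi (by exact_mod_cast hR)
  have hd : DifferentiableAt ℂ (fun w => (2 * Real.pi * Complex.I : ℂ)⁻¹ •
      ∮ z in C(c, R), (z - w)⁻¹ • g z) c := hps.analyticAt.differentiableAt
  refine hd.congr_of_eventuallyEq ?_
  filter_upwards [Metric.ball_mem_nhds c hR] with w hw
  have h1 : ∀ n, (2 * Real.pi * Complex.I : ℂ)⁻¹ • ∮ z in C(c, R), (z - w)⁻¹ • f n z = f n w := by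
    intro n
    exact DiffContOnCl.two_pi_i_inv_smul_circleIntegral_sub_inv_smul
      (((hf n).diffContOnCl_ball (subset_refl _))) hw
  have h2 : Tendsto (fun n => (2 * Real.pi * Complex.I : ℂ)⁻¹ •
      ∮ z in C(c, R), (z - w)⁻¹ • f n z) atTop
      (nhds ((2 * Real.pi * Complex.I : ℂ)⁻¹ • ∮ z in C(c, R), (z - w)⁻¹ • g z)) := by
    refine Tendsto.const_smul ?_ _
    unfold circleIntegral
    have hw' : ∀ θ, circleMap c R θ - w ≠ 0 := by
      intro θ h0
      have := circleMap_mem_sphere c hR.le θ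
      rw [sub_eq_zero] at h0
      rw [h0] at this
      simp only [Metric.mem_sphere, Metric.mem_ball] at this hw
      linarith
    have hk : Continuous (fun θ => deriv (circleMap c R) θ * (circleMap c R θ - w)⁻¹) := by
      refine Continuous.mul ?_ (((continuous_circleMap c R).sub continuous_const).inv₀ hw')
      have : deriv (circleMap c R) = fun θ => circleMap 0 R θ * Complex.I := by
        funext θ; exact deriv_circleMap c R θ
      rw [this]
      exact (continuous_circleMap 0 R).mul continuous_const
    refine intervalIntegral.tendsto_integral_filter_of_dominated_convergence
      (fun θ => ‖deriv (circleMap c R) θ * (circleMap c R θ - w)⁻¹‖ * C) ?_ ?_ ?_ ?_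
    · refine Eventually.of_forall fun n => ?_
      have : Continuous fun θ => deriv (circleMap c R) θ • (circleMap c R θ - w)⁻¹ •
          f n (circleMap c R θ) := by
        have := hk.fun_mul (hcont n)
        simpa only [smul_eq_mul, mul_assoc] using this
      exact this.aestronglyMeasurable
    · refine Eventually.of_forall fun n => Eventually.of_forall fun θ _ => ?_
      simp only [smul_eq_mul]
      rw [← mul_assoc, norm_mul]
      exact mul_le_mul_of_nonneg_left (hb n _ (hmem θ)) (norm_nonneg _)
    · exact (hk.norm.mul continuous_const).intervalIntegrable _ _
    · refine Eventually.of_forall fun θ _ => ?_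
      exact ((hg _ (hmem θ)).const_smul _).const_smul _
  simp only [h1] at h2
  exact tendsto_nhds_unique (hg w (Metric.ball_subset_closedBall hw)) h2


section IVP
variable {E : Type*} [NormedAddCommGroup E] [NormedSpace ℂ E] [CompleteSpace E]

/-- Picard terms of the linear ODE with coefficient `A₀ + μ A₁`. -/
noncomputable def picTerm (A₀ A₁ : ℝ → E →L[ℂ] E) (u₀ : ℝ → E) : ℕ → ℂ → ℝ → E
  | 0, _, t => u₀ t
  | n + 1, μ, t => ∫ s in (0:ℝ)..t, (A₀ s + μ • A₁ s) (picTerm A₀ A₁ u₀ n μ s)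

lemma picTerm_continuous {A₀ A₁ : ℝ → E →L[ℂ] E} {u₀ : ℝ → E} (h₀ : Continuous A₀)
    (h₁ : Continuous A₁) (hu : Continuous u₀) (μ : ℂ) (n : ℕ) :
    Continuous (picTerm A₀ A₁ u₀ n μ) := by
  induction n with
  | zero => exact hu
  | succ n ih =>
    have : Continuous fun s => (A₀ s + μ • A₁ s) (picTerm A₀ A₁ u₀ n μ s) :=
      (h₀.add (h₁.const_smul μ)).clm_apply ih
    exact intervalIntegral.continuous_primitive (fun a b => this.intervalIntegrable a b) 0

lemma picTerm_differentiable {A₀ A₁ : ℝ → E →L[ℂ] E} {u₀ : ℝ → E} (h₀ : Continuous A₀)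
    (h₁ : Continuous A₁) (hu : Continuous u₀) (t : ℝ) (n : ℕ) :
    Differentiable ℂ (fun μ => picTerm A₀ A₁ u₀ n μ t) := by
  have key : ∃ c : ℕ → ℝ → E, (∀ j, Continuous (c j)) ∧
      ∀ μ t, picTerm A₀ A₁ u₀ n μ t = ∑ j ∈ Finset.range (n + 1), μ ^ j • c j t := by
    clear t
    induction n with
    | zero => exact ⟨fun _ => u₀, fun _ => hu, fun μ t => by simp [picTerm]⟩
    | succ n ih =>
      obtain ⟨c, hc, hs⟩ := ih
      have hc0 : ∀ j, Continuous fun s => A₀ s (c j s) := fun j => h₀.clm_apply (hc j)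
      have hc1 : ∀ j, Continuous fun s => A₁ s (c j s) := fun j => h₁.clm_apply (hc j)
      let p : ℕ → ℝ → E := fun j t => if j < n + 1 then ∫ s in (0:ℝ)..t, A₀ s (c j s) else 0
      let q : ℕ → ℝ → E := fun j t => ∫ s in (0:ℝ)..t, A₁ s (c j s)
      have hp : ∀ j, Continuous (p j) := by
        intro j
        by_cases hj : j < n + 1
        · simp only [p, hj, if_true]
          exact intervalIntegral.continuous_primitive (fun a b => (hc0 j).intervalIntegrable a b) 0
        · simp only [p, hj, if_false]
          exact continuous_const
      have hq : ∀ j, Continuous (q j) := fun j =>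
        intervalIntegral.continuous_primitive (fun a b => (hc1 j).intervalIntegrable a b) 0
      refine ⟨fun j t => p j t + (match j with | 0 => 0 | j + 1 => q j t), ?_, ?_⟩
      · rintro (_ | j)
        · simpa using hp 0
        · exact (hp (j + 1)).add (hq j)
      · intro μ t
        have e1 : picTerm A₀ A₁ u₀ (n + 1) μ t =
            ∫ s in (0:ℝ)..t, ∑ j ∈ Finset.range (n + 1),
              (μ ^ j • A₀ s (c j s) + μ ^ (j + 1) • A₁ s (c j s)) := by
          rw [picTerm]
          refine intervalIntegral.integral_congr fun s _ => ?_
          simp only [hs, map_sum, map_smul, _root_.add_apply,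
            _root_.smul_apply, smul_add, smul_smul, pow_succ]
        have e3 : ∀ j ∈ Finset.range (n + 1), IntervalIntegrable
            (fun s => μ ^ j • A₀ s (c j s) + μ ^ (j + 1) • A₁ s (c j s)) volume 0 t := fun j _ =>
          (((hc0 j).const_smul (μ ^ j)).add ((hc1 j).const_smul (μ ^ (j+1)))).intervalIntegrable _ _
        rw [e1, intervalIntegral.integral_finsetSum e3]
        have e2 : ∀ j ∈ Finset.range (n + 1), (∫ s in (0:ℝ)..t,
            (μ ^ j • A₀ s (c j s) + μ ^ (j + 1) • A₁ s (c j s))) =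
            μ ^ j • p j t + μ ^ (j + 1) • q j t := by
          intro j hj
          have f0 : Continuous fun s => μ ^ j • A₀ s (c j s) := (hc0 j).const_smul _
          have f1 : Continuous fun s => μ ^ (j + 1) • A₁ s (c j s) := (hc1 j).const_smul _
          rw [intervalIntegral.integral_add (f0.intervalIntegrable _ _)
            (f1.intervalIntegrable _ _), intervalIntegral.integral_smul,
            intervalIntegral.integral_smul]
          simp only [p, q, Finset.mem_range.1 hj, if_true]
        rw [Finset.sum_congr rfl e2, Finset.sum_add_distrib]
        simp only [smul_add, Finset.sum_add_distrib]
        congr 1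
        · rw [Finset.sum_range_succ _ (n + 1)]
          simp [p]
        · rw [Finset.sum_range_succ' _ (n + 1)]
          simp
  obtain ⟨c, -, hs⟩ := key
  simp only [hs]
  fun_prop

lemma picTerm_bound {A₀ A₁ : ℝ → E →L[ℂ] E} {u₀ : ℝ → E} 
    {T M C : ℝ} (hM : ∀ t, |t| ≤ T → ‖u₀ t‖ ≤ M) {μ : ℂ}
    (hC : ∀ t, |t| ≤ T → ‖A₀ t + μ • A₁ t‖ ≤ C) (hC0 : 0 ≤ C) (n : ℕ) :
    ∀ t, |t| ≤ T → ‖picTerm A₀ A₁ u₀ n μ t‖ ≤ M * (C * |t|) ^ n / n.factorial := by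
  induction n with
  | zero => intro t ht; simpa [picTerm] using hM t ht
  | succ n ih =>
    intro t ht
    have hM0 : 0 ≤ M := (norm_nonneg _).trans (hM t ht)
    have hb : ∀ s, |s| ≤ |t| → ‖(A₀ s + μ • A₁ s) (picTerm A₀ A₁ u₀ n μ s)‖ ≤
        C * (M * (C * |s|) ^ n / n.factorial) := by
      intro s hs
      refine (ContinuousLinearMap.le_opNorm _ _).trans ?_
      exact mul_le_mul (hC s (hs.trans ht)) (ih s (hs.trans ht)) (norm_nonneg _) hC0
    have hintegr : ∀ r : ℝ, 0 ≤ r → ∫ s in (0:ℝ)..r, C * (M * (C * s) ^ n / n.factorial) =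
        M * (C * r) ^ (n+1) / (n+1).factorial := by
      intro r hr
      have : (fun s : ℝ => C * (M * (C * s) ^ n / n.factorial)) =
          fun s => (C * M * C ^ n / n.factorial) * s ^ n := by
        funext s; rw [mul_pow]; ring
      rw [this, intervalIntegral.integral_const_mul, integral_pow]
      rw [Nat.factorial_succ]
      push_cast
      have h1 : (n:ℝ) + 1 ≠ 0 := by positivity
      have h2 : (n.factorial : ℝ) ≠ 0 := by positivity
      field_simp
      ring
    rw [picTerm]
    rcases le_total 0 t with h | h
    · rw [abs_of_nonneg h] at hb ⊢
      rw [← hintegr t h]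
      refine intervalIntegral.norm_integral_le_of_norm_le h ?_ ?_
      · refine Eventually.of_forall fun s hs => ?_
        have := hb s (by rw [abs_of_pos hs.1]; exact hs.2)
        rwa [abs_of_pos hs.1] at this
      · exact Continuous.intervalIntegrable (by fun_prop) _ _
    · rw [abs_of_nonpos h] at hb ⊢
      rw [← hintegr (-t) (by linarith)]
      have hcv := intervalIntegral.integral_comp_neg (a := 0) (b := -t)
        (fun s => (A₀ s + μ • A₁ s) (picTerm A₀ A₁ u₀ n μ s))
      rw [neg_neg, neg_zero] at hcv
      rw [intervalIntegral.integral_symm, norm_neg, ← hcv]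
      refine intervalIntegral.norm_integral_le_of_norm_le (by linarith) ?_ ?_
      · refine Eventually.of_forall fun s hs => ?_
        have := hb (-s) (by rw [abs_neg, abs_of_pos hs.1]; exact hs.2)
        rwa [abs_neg, abs_of_pos hs.1] at this
      · exact Continuous.intervalIntegrable (by fun_prop) _ _

/-- Global solvability of linear ODEs with analytic dependence on the parameter. -/
lemma linear_ivp (A₀ A₁ : ℝ → E →L[ℂ] E) (b : ℝ → E) (x₀ : E) (h₀ : Continuous A₀)
    (h₁ : Continuous A₁) (hb : Continuous b) :
    ∃ X : ℂ → ℝ → E, (∀ μ, X μ 0 = x₀) ∧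
      (∀ μ t, HasDerivAt (X μ) ((A₀ t + μ • A₁ t) (X μ t) + b t) t) ∧
      ∀ t, Differentiable ℂ (fun μ => X μ t) := by
  let u₀ : ℝ → E := fun t => x₀ + ∫ s in (0:ℝ)..t, b s
  have hu : Continuous u₀ := continuous_const.add
    (intervalIntegral.continuous_primitive (fun a b => hb.intervalIntegrable a b) 0)
  have hcA : ∀ μ : ℂ, Continuous fun t => A₀ t + μ • A₁ t := fun μ => h₀.add (h₁.const_smul μ)
  -- uniform bounds
  have hbd : ∀ T R : ℝ, 0 ≤ R → ∃ v : ℕ → ℝ, Summable v ∧ ∀ n (μ : ℂ) t, ‖μ‖ ≤ R → |t| ≤ T →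
      ‖picTerm A₀ A₁ u₀ n μ t‖ ≤ v n := by
    intro T R hR
    obtain ⟨M, hM⟩ := (isCompact_Icc (a := -T) (b := T)).exists_bound_of_continuousOn hu.continuousOn
    obtain ⟨C0, hC0⟩ := (isCompact_Icc (a := -T) (b := T)).exists_bound_of_continuousOn
      h₀.continuousOn
    obtain ⟨C1, hC1⟩ := (isCompact_Icc (a := -T) (b := T)).exists_bound_of_continuousOn
      h₁.continuousOn
    refine ⟨fun n => |M| * ((|C0| + R * |C1|) * T) ^ n / n.factorial, ?_, ?_⟩
    · have := (Real.summable_pow_div_factorial ((|C0| + R * |C1|) * T)).mul_left |M|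
      simpa only [mul_div_assoc] using this
    · intro n μ t hμ ht
      have hmem : ∀ t, |t| ≤ T → t ∈ Icc (-T) T := fun t ht => abs_le.1 ht
      refine (picTerm_bound (T := T) (M := |M|) (C := |C0| + R * |C1|)
        (fun t ht => (hM t (hmem t ht)).trans (le_abs_self _)) ?_ (by positivity) n t ht).trans ?_
      · intro t ht
        refine (norm_add_le _ _).trans (add_le_add ((hC0 t (hmem t ht)).trans (le_abs_self _)) ?_)
        rw [norm_smul]
        exact mul_le_mul hμ ((hC1 t (hmem t ht)).trans (le_abs_self _)) (norm_nonneg _) hR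
      · beta_reduce
        gcongr
  let X : ℂ → ℝ → E := fun μ t => ∑' n, picTerm A₀ A₁ u₀ n μ t
  have hsum : ∀ μ t, Summable fun n => picTerm A₀ A₁ u₀ n μ t := by
    intro μ t
    obtain ⟨v, hv, hle⟩ := hbd |t| ‖μ‖ (norm_nonneg _)
    exact Summable.of_norm_bounded hv fun n => hle n μ t le_rfl le_rfl
  have hXc : ∀ μ, Continuous (X μ) := by
    intro μ
    rw [continuous_iff_continuousAt]
    intro t
    obtain ⟨v, hv, hle⟩ := hbd (|t| + 1) ‖μ‖ (norm_nonneg _)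
    have : ContinuousOn (X μ) {s | |s| ≤ |t| + 1} := by
      refine continuousOn_tsum (u := v) (fun n => (picTerm_continuous h₀ h₁ hu μ n).continuousOn) hv ?_
      intro n s hs
      exact hle n μ s le_rfl hs
    refine this.continuousAt ?_
    filter_upwards [(continuous_abs.tendsto t).eventually (gt_mem_nhds (lt_add_one |t|))] with s hs
    exact le_of_lt hs
  have hXeq : ∀ μ t, X μ t = u₀ t + ∫ s in (0:ℝ)..t, (A₀ s + μ • A₁ s) (X μ s) := by
    intro μ t
    obtain ⟨v, hv, hle⟩ := hbd |t| ‖μ‖ (norm_nonneg _)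
    obtain ⟨C, hC⟩ := (isCompact_uIcc (a := (0:ℝ)) (b := t)).exists_bound_of_continuousOn
      (hcA μ).continuousOn
    have hs' : ∀ s ∈ uIoc 0 t, |s| ≤ |t| := by
      intro s hs
      rcases le_total 0 t with h | h
      · rw [uIoc_of_le h] at hs
        rw [abs_of_pos hs.1, abs_of_nonneg h]; exact hs.2
      · rw [uIoc_of_ge h] at hs
        rw [abs_of_nonpos hs.2, abs_of_nonpos h]; linarith [hs.1]
    have h1 : HasSum (fun n => ∫ s in (0:ℝ)..t, (A₀ s + μ • A₁ s) (picTerm A₀ A₁ u₀ n μ s))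
        (∫ s in (0:ℝ)..t, (A₀ s + μ • A₁ s) (X μ s)) := by
      refine intervalIntegral.hasSum_integral_of_dominated_convergence (fun n _ => |C| * v n)
        (fun n => ((hcA μ).clm_apply (picTerm_continuous h₀ h₁ hu μ n)).aestronglyMeasurable)
        ?_ ?_ ?_ ?_
      · intro n
        refine Eventually.of_forall fun s hs => ?_
        refine (ContinuousLinearMap.le_opNorm _ _).trans ?_
        exact mul_le_mul ((hC s (uIoc_subset_uIcc hs)).trans (le_abs_self _))
          (hle n μ s le_rfl (hs' s hs)) (norm_nonneg _) (abs_nonneg _)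
      · exact Eventually.of_forall fun s _ => hv.mul_left _
      · exact intervalIntegrable_const
      · exact Eventually.of_forall fun s _ => (hsum μ s).hasSum.mapL _
    have h2 : X μ t = picTerm A₀ A₁ u₀ 0 μ t + ∑' n, picTerm A₀ A₁ u₀ (n+1) μ t :=
      (hsum μ t).tsum_eq_zero_add
    rw [h2]
    congr 1
    exact h1.tsum_eq
  refine ⟨X, ?_, ?_, ?_⟩
  · intro μ; rw [hXeq]; simp [u₀]
  · intro μ t
    have h1 : HasDerivAt (fun t => u₀ t + ∫ s in (0:ℝ)..t, (A₀ s + μ • A₁ s) (X μ s))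
        (b t + (A₀ t + μ • A₁ t) (X μ t)) t := by
      refine HasDerivAt.add ?_ ?_
      · exact ((hb.integral_hasStrictDerivAt 0 t).hasDerivAt).const_add x₀
      · exact (((hcA μ).clm_apply (hXc μ)).integral_hasStrictDerivAt 0 t).hasDerivAt
    rw [add_comm]
    have : X μ = fun t => u₀ t + ∫ s in (0:ℝ)..t, (A₀ s + μ • A₁ s) (X μ s) := funext (hXeq μ)
    rw [this] at h1 ⊢
    rw [← this] at h1 ⊢
    rw [← this] at h1
    exact h1
  · intro t μ
    obtain ⟨v, hv, hle⟩ := hbd |t| (‖μ‖ + 1) (by positivity)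
    have : DifferentiableOn ℂ (fun μ => ∑' n, picTerm A₀ A₁ u₀ n μ t) (Metric.ball 0 (‖μ‖ + 1)) :=
      Complex.differentiableOn_tsum_of_summable_norm hv
        (fun n => (picTerm_differentiable h₀ h₁ hu t n).differentiableOn) Metric.isOpen_ball
        (fun n w hw => hle n w t (by simpa using (mem_ball_zero_iff.1 hw).le) le_rfl)
    exact this.differentiableAt (Metric.isOpen_ball.mem_nhds (by simp))
end IVP


section Energy
open ComplexConjugate

set_option maxHeartbeats 2000000 in
lemma energy_pointwise {μ : ℂ} {k η M : ℝ} (hk : 0 < k) (hη : 0 < η) (hμ : η ≤ μ.im)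
    {u u1 u2 u3 : ℝ} (hu : |u| ≤ 1) (hu1 : |u1| ≤ M) (hu2 : |u2| ≤ M)
    {h0 h1 h2 h3 f : ℂ}
    (hode : (μ - u) ^ 2 * h1 - Complex.I / (k:ℂ) *
      ((μ - u) * h3 - 3 * u1 * h2 - 3 * u2 * h1 - u3 * h0) = f) :
    ‖h1‖ ^ 2 * (3/4 - (8 * M ^ 2 / η ^ 3 + 3 * M / η ^ 2 + 1 / (2 * η ^ 2)) / k)
      + η / (2 * k * (‖μ‖ + 1) ^ 2) * ‖h2‖ ^ 2
      - 1 / (2 * k * η ^ 2) * (u3 ^ 2 * ‖h0‖ ^ 2) - ‖f‖ ^ 2 / η ^ 4 ≤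
    (Complex.I / (k:ℂ) * ((h3 * conj h1 + h2 * conj h2) / (μ - u)
      + h2 * conj h1 * u1 / (μ - u) ^ 2)).re := by
  set m : ℂ := μ - u with hm
  have hmim : m.im = μ.im := by simp [hm]
  have hM : 0 ≤ M := (abs_nonneg _).trans hu1
  have hkc : (k:ℂ) ≠ 0 := by exact_mod_cast hk.ne'
  have hτ : 0 < μ.im := lt_of_lt_of_le hη hμ
  have hm0 : m ≠ 0 := by
    intro h; rw [h] at hmim; simp at hmim; linarith
  have hmη : η ≤ ‖m‖ := hμ.trans (hmim ▸ (le_abs_self _).trans (Complex.abs_im_le_norm m))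
  have hmτ : μ.im ≤ ‖m‖ := (hmim ▸ (le_abs_self _).trans (Complex.abs_im_le_norm m))
  have hmu : ‖m‖ ≤ ‖μ‖ + 1 := by
    refine (norm_sub_le _ _).trans ?_
    rw [Complex.norm_real, Real.norm_eq_abs]; linarith
  have hmp : 0 < ‖m‖ := lt_of_lt_of_le hη hmη
  -- the identity
  have hid : Complex.I / (k:ℂ) * ((h3 * conj h1 + h2 * conj h2) / m + h2 * conj h1 * u1 / m ^ 2)
      = h1 * conj h1 + (Complex.I / k) * (h2 * conj h2) / m
        + ((Complex.I / k) * (4 * u1 * h2 + 3 * u2 * h1 + u3 * h0) - f) * conj h1 / m ^ 2 := by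
    rw [← hode]
    field_simp
    ring
  rw [hid, Complex.add_re, Complex.add_re]
  have e1 : (h1 * conj h1).re = ‖h1‖ ^ 2 := by
    rw [Complex.mul_conj, Complex.ofReal_re, Complex.normSq_eq_norm_sq]
  have e2 : ((Complex.I / k) * (h2 * conj h2) / m).re = μ.im / (k * ‖m‖ ^ 2) * ‖h2‖ ^ 2 := by
    rw [Complex.mul_conj, Complex.normSq_eq_norm_sq, ← hmim, ← Complex.normSq_eq_norm_sq m]
    have : (Complex.I / k) * ((‖h2‖ ^ 2 : ℝ) : ℂ) / m = ((‖h2‖ ^ 2 / k : ℝ) : ℂ) * (Complex.I / m) := by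
      push_cast; field_simp
    rw [this, Complex.re_ofReal_mul, Complex.div_re]
    simp
    field_simp
  have e3 : -(((4 * |u1| * ‖h2‖ + 3 * |u2| * ‖h1‖ + |u3| * ‖h0‖) / k + ‖f‖) * ‖h1‖ / ‖m‖ ^ 2) ≤
      (((Complex.I / k) * (4 * u1 * h2 + 3 * u2 * h1 + u3 * h0) - f) * conj h1 / m ^ 2).re := by
    refine (neg_le_neg ?_).trans (neg_le_of_abs_le (Complex.abs_re_le_norm _))
    rw [norm_div, norm_mul, norm_pow, RCLike.norm_conj]
    gcongr
    refine (norm_sub_le _ _).trans ?_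
    gcongr
    rw [norm_mul, norm_div, Complex.norm_I, Complex.norm_real, Real.norm_eq_abs, abs_of_pos hk,
      one_div, inv_mul_eq_div]
    gcongr
    refine (norm_add₃_le).trans ?_
    simp [Complex.norm_real]
  rw [e1, e2]
  refine le_trans ?_ (add_le_add_right e3 _)
  -- real inequality
  set a := ‖h1‖
  set b := ‖h2‖
  set c := ‖h0‖
  set g := ‖f‖
  set τ := μ.im
  have ha : 0 ≤ a := norm_nonneg _
  have hb : 0 ≤ b := norm_nonneg _
  have hc : 0 ≤ c := norm_nonneg _
  have hg : 0 ≤ g := norm_nonneg _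
  set r := (‖m‖ ^ 2)⁻¹ with hr
  have hr0 : 0 < r := by positivity
  have hrη : r ≤ (η ^ 2)⁻¹ := by
    rw [hr]; gcongr
  -- pieces
  have i1 : 4 * |u1| * b * a * r ≤ τ / 2 * r * b ^ 2 + 8 * M ^ 2 / η ^ 3 * a ^ 2 := by
    have h1 : 4 * |u1| * b * a ≤ τ / 2 * b ^ 2 + 8 / τ * (|u1| * a) ^ 2 := by
      have : 0 ≤ (τ * b - 4 * (|u1| * a)) ^ 2 / (2 * τ) := by positivity
      have e : (τ * b - 4 * (|u1| * a)) ^ 2 / (2 * τ) =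
        τ / 2 * b ^ 2 + 8 / τ * (|u1| * a) ^ 2 - 4 * |u1| * b * a := by field_simp; ring
      linarith
    have h2 : 8 / τ * (|u1| * a) ^ 2 * r ≤ 8 / η * (M * a) ^ 2 * (η ^ 2)⁻¹ := by gcongr
    have h3 : 8 / η * (M * a) ^ 2 * (η ^ 2)⁻¹ = 8 * M ^ 2 / η ^ 3 * a ^ 2 := by field_simp
    nlinarith [mul_le_mul_of_nonneg_right h1 hr0.le]
  have i2 : 3 * |u2| * a * a * r ≤ 3 * M / η ^ 2 * a ^ 2 := by
    have h2 : 3 * |u2| * a * a * r ≤ 3 * M * a * a * (η ^ 2)⁻¹ := by gcongr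
    calc _ ≤ _ := h2
      _ = _ := by field_simp
  have i3 : |u3| * c * a * r ≤ 1 / (2 * η ^ 2) * a ^ 2 + 1 / (2 * η ^ 2) * (u3 ^ 2 * c ^ 2) := by
    have h1 : |u3| * c * a ≤ (a ^ 2 + u3 ^ 2 * c ^ 2) / 2 := by
      rw [← sq_abs u3]; nlinarith [sq_nonneg (|u3| * c - a)]
    have h2 : |u3| * c * a * r ≤ (a ^ 2 + u3 ^ 2 * c ^ 2) / 2 * (η ^ 2)⁻¹ := by gcongr
    calc _ ≤ _ := h2
      _ = _ := by field_simp
  have i4 : g * a * r ≤ a ^ 2 / 4 + g ^ 2 / η ^ 4 := by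
    have h2 : g * a * r ≤ g * a * (η ^ 2)⁻¹ := by gcongr
    have h3 : 0 ≤ (a / 2 - g * (η ^ 2)⁻¹) ^ 2 := sq_nonneg _
    have h4 : g ^ 2 / η ^ 4 = (g * (η ^ 2)⁻¹) ^ 2 := by field_simp
    rw [h4]; nlinarith
  have i5 : η / (2 * k * (‖μ‖ + 1) ^ 2) * b ^ 2 ≤ (τ / 2 * r * b ^ 2) / k := by
    have h1 : η / (2 * (‖μ‖ + 1) ^ 2) ≤ τ / 2 * r := by
      rw [hr, ← div_eq_mul_inv, div_div]; gcongr
    calc _ = η / (2 * (‖μ‖ + 1) ^ 2) * b ^ 2 / k := by field_simp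
      _ ≤ _ := by gcongr
  have j : (4 * |u1| * b * a * r + 3 * |u2| * a * a * r + |u3| * c * a * r) / k ≤
      (τ / 2 * r * b ^ 2 + 8 * M ^ 2 / η ^ 3 * a ^ 2 + 3 * M / η ^ 2 * a ^ 2 +
       (1 / (2 * η ^ 2) * a ^ 2 + 1 / (2 * η ^ 2) * (u3 ^ 2 * c ^ 2))) / k := by
    gcongr
  have e4 : ((4 * |u1| * b + 3 * |u2| * a + |u3| * c) / k + g) * a / ‖m‖ ^ 2 =
      (4 * |u1| * b * a * r + 3 * |u2| * a * a * r + |u3| * c * a * r) / k + g * a * r := by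
    rw [hr]; field_simp
  have e5 : τ / (k * ‖m‖ ^ 2) * b ^ 2 = 2 * ((τ / 2 * r * b ^ 2) / k) := by
    rw [hr]; field_simp
  rw [e4, e5]
  have e6 : (τ / 2 * r * b ^ 2 + 8 * M ^ 2 / η ^ 3 * a ^ 2 + 3 * M / η ^ 2 * a ^ 2 +
       (1 / (2 * η ^ 2) * a ^ 2 + 1 / (2 * η ^ 2) * (u3 ^ 2 * c ^ 2))) / k =
       (τ / 2 * r * b ^ 2) / k +
       a ^ 2 * ((8 * M ^ 2 / η ^ 3 + 3 * M / η ^ 2 + 1 / (2 * η ^ 2)) / k) +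
       1 / (2 * k * η ^ 2) * (u3 ^ 2 * c ^ 2) := by field_simp; ring
  rw [e6] at j
  rw [mul_sub]
  linarith

/-- Cauchy-Schwarz for primitives. -/
lemma norm_sq_le_of_primitive {h0 h1 : ℝ → ℂ} (hd : ∀ y, HasDerivAt h0 (h1 y) y)
    (hc : Continuous h1) (h00 : h0 0 = 0) {y : ℝ} (hy : 0 ≤ y) :
    ‖h0 y‖ ^ 2 ≤ y * ∫ s in (0:ℝ)..y, ‖h1 s‖ ^ 2 := by
  rcases hy.eq_or_lt with rfl | hy
  · simp [h00]
  have e : h0 y = ∫ s in (0:ℝ)..y, h1 s := by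
    rw [intervalIntegral.integral_eq_sub_of_hasDerivAt (fun s _ => hd s)
      (hc.intervalIntegrable _ _), h00, sub_zero]
  set I := ∫ s in (0:ℝ)..y, ‖h1 s‖
  have hle : ‖h0 y‖ ≤ I := by
    rw [e]; exact intervalIntegral.norm_integral_le_integral_norm hy.le
  have hI : I ^ 2 ≤ y * ∫ s in (0:ℝ)..y, ‖h1 s‖ ^ 2 := by
    have h0 : 0 ≤ ∫ s in (0:ℝ)..y, (‖h1 s‖ - I / y) ^ 2 :=
      intervalIntegral.integral_nonneg hy.le fun s _ => sq_nonneg _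
    have h1' : ∫ s in (0:ℝ)..y, (‖h1 s‖ - I / y) ^ 2 =
        (∫ s in (0:ℝ)..y, ‖h1 s‖ ^ 2) - 2 * (I / y) * I + y * (I / y) ^ 2 := by
      have : ∀ s, (‖h1 s‖ - I / y) ^ 2 = ‖h1 s‖ ^ 2 - 2 * (I / y) * ‖h1 s‖ + (I / y) ^ 2 := by
        intro s; ring
      simp only [this]
      rw [intervalIntegral.integral_add, intervalIntegral.integral_sub,
        intervalIntegral.integral_const_mul, intervalIntegral.integral_const]
      · simp [I]
      all_goals exact Continuous.intervalIntegrable (by fun_prop) _ _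
    rw [h1'] at h0
    have h2 : -2 * (I / y) * I + y * (I / y) ^ 2 = - (I ^ 2 / y) := by field_simp; ring
    have h3 : I ^ 2 / y ≤ ∫ s in (0:ℝ)..y, ‖h1 s‖ ^ 2 := by linarith
    rw [div_le_iff₀ hy] at h3
    linarith
  calc ‖h0 y‖ ^ 2 ≤ I ^ 2 := by gcongr
    _ ≤ _ := hI

end Energy

section Energy2
open ComplexConjugate

/-- boundary flux -/
noncomputable def flux (U : ℝ → ℝ) (μ : ℂ) (k : ℝ) (h1 h2 : ℝ → ℂ) (y : ℝ) : ℝ :=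
  (Complex.I / (k:ℂ) * (h2 y * conj (h1 y) / (μ - U y))).re

lemma sub_ne_zero_of_im {μ : ℂ} (h : 0 < μ.im) (u : ℝ) : μ - (u:ℂ) ≠ 0 := by
  intro h0
  have := congrArg Complex.im h0
  simp at this
  linarith

lemma im_le_norm_sub {μ : ℂ} (u : ℝ) : μ.im ≤ ‖μ - (u:ℂ)‖ := by
  have := (le_abs_self _).trans (Complex.abs_im_le_norm (μ - (u:ℂ)))
  simpa using this

lemma energy_integrated {U U1 U2 U3 : ℝ → ℝ} {M M3 η k : ℝ} {μ : ℂ} (hη : 0 < η) (hk : 0 < k)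
    (hμ : η ≤ μ.im)
    (hkK : 4 * (8 * M ^ 2 / η ^ 3 + 3 * M / η ^ 2 + 1 / (2 * η ^ 2) + M3 / (2 * η ^ 2)) ≤ k)
    (hUd : ∀ y, HasDerivAt U (U1 y) y) (hU1c : Continuous U1)
    (hU3c : Continuous U3)
    (hU : ∀ y, 0 ≤ y → |U y| ≤ 1) (hU1 : ∀ y, 0 ≤ y → |U1 y| ≤ M) (hU2 : ∀ y, 0 ≤ y → |U2 y| ≤ M)
    (hU3 : ∀ N, 0 ≤ N → ∫ y in (0:ℝ)..N, y * U3 y ^ 2 ≤ M3)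
    {h0 h1 h2 h3 f : ℝ → ℂ} (hd0 : ∀ y, HasDerivAt h0 (h1 y) y)
    (hd1 : ∀ y, HasDerivAt h1 (h2 y) y) (hd2 : ∀ y, HasDerivAt h2 (h3 y) y)
    (hc3 : Continuous h3) (hfc : Continuous f) (h00 : h0 0 = 0)
    (hode : ∀ y, 0 ≤ y → (μ - U y) ^ 2 * h1 y - Complex.I / (k:ℂ) *
      ((μ - U y) * h3 y - 3 * U1 y * h2 y - 3 * U2 y * h1 y - U3 y * h0 y) = f y)
    {N : ℝ} (hN : 0 ≤ N) :
    1 / 2 * (∫ y in (0:ℝ)..N, ‖h1 y‖ ^ 2) + η / (2 * k * (‖μ‖ + 1) ^ 2) * (∫ y in (0:ℝ)..N, ‖h2 y‖ ^ 2)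
      ≤ flux U μ k h1 h2 N - flux U μ k h1 h2 0 + (∫ y in (0:ℝ)..N, ‖f y‖ ^ 2) / η ^ 4 := by
  have hτ : 0 < μ.im := lt_of_lt_of_le hη hμ
  have hm0 : ∀ y, μ - (U y : ℂ) ≠ 0 := fun y => sub_ne_zero_of_im hτ _
  have hUc : Continuous U := continuous_iff_continuousAt.2 fun y => (hUd y).continuousAt
  have hc0 : Continuous h0 := continuous_iff_continuousAt.2 fun y => (hd0 y).continuousAt
  have hc1 : Continuous h1 := continuous_iff_continuousAt.2 fun y => (hd1 y).continuousAt
  have hc2 : Continuous h2 := continuous_iff_continuousAt.2 fun y => (hd2 y).continuousAt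
  have hmc : Continuous fun y => μ - (U y : ℂ) := by fun_prop
  have hcc : Continuous fun y => conj (h1 y) := Complex.continuous_conj.comp hc1
  have hcc2 : Continuous fun y => conj (h2 y) := Complex.continuous_conj.comp hc2
  set B' : ℝ → ℝ := fun y => (Complex.I / (k:ℂ) * ((h3 y * conj (h1 y) + h2 y * conj (h2 y)) /
      (μ - U y) + h2 y * conj (h1 y) * U1 y / (μ - U y) ^ 2)).re with hB'
  have hB'c : Continuous B' := by
    refine Complex.continuous_re.comp (continuous_const.mul ?_)
    refine Continuous.add (Continuous.div (by fun_prop) hmc hm0) ?_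
    refine Continuous.div ?_ (hmc.pow 2) (fun y => pow_ne_zero 2 (hm0 y))
    exact (hc2.mul hcc).mul (Complex.continuous_ofReal.comp hU1c)
  have hBd : ∀ y, HasDerivAt (flux U μ k h1 h2) (B' y) y := by
    intro y
    have hconj : HasDerivAt (fun y => conj (h1 y)) (conj (h2 y)) y := (hd1 y).star
    have hden : HasDerivAt (fun y => μ - (U y : ℂ)) (-(U1 y : ℂ)) y :=
      ((hUd y).ofReal_comp).const_sub μ
    have h := ((((hd2 y).mul hconj).div hden (hm0 y)).const_mul (Complex.I / (k:ℂ)))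
    have h' := (Complex.reCLM.hasFDerivAt.comp_hasDerivAt y h)
    refine HasDerivAt.congr_deriv h' ?_
    simp only [hB', Complex.reCLM_apply, Pi.mul_apply]
    congr 2
    have := hm0 y
    field_simp
    ring
  have hFTC : ∫ y in (0:ℝ)..N, B' y = flux U μ k h1 h2 N - flux U μ k h1 h2 0 :=
    intervalIntegral.integral_eq_sub_of_hasDerivAt (fun y _ => hBd y) (hB'c.intervalIntegrable _ _)
  set S := ∫ y in (0:ℝ)..N, ‖h1 y‖ ^ 2 with hS
  have hS0 : 0 ≤ S := intervalIntegral.integral_nonneg hN fun y _ => sq_nonneg _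
  set C1 := 8 * M ^ 2 / η ^ 3 + 3 * M / η ^ 2 + 1 / (2 * η ^ 2) with hC1
  set c := η / (2 * k * (‖μ‖ + 1) ^ 2) with hc
  have hpt : ∀ y ∈ Icc 0 N, ‖h1 y‖ ^ 2 * (3/4 - C1 / k) + c * ‖h2 y‖ ^ 2
      - (1 / (2 * k * η ^ 2) * S) * (y * U3 y ^ 2) - ‖f y‖ ^ 2 / η ^ 4 ≤ B' y := by
    intro y hy
    refine le_trans ?_ (energy_pointwise hk hη hμ (hU y hy.1) (hU1 y hy.1) (hU2 y hy.1)
      (hode y hy.1))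
    have h1' : ‖h0 y‖ ^ 2 ≤ y * S := by
      refine (norm_sq_le_of_primitive hd0 hc1 h00 hy.1).trans ?_
      refine mul_le_mul_of_nonneg_left ?_ hy.1
      refine intervalIntegral.integral_mono_interval le_rfl hy.1 hy.2
        (Eventually.of_forall fun y => sq_nonneg _) (Continuous.intervalIntegrable (by fun_prop) _ _)
    have h2' : 1 / (2 * k * η ^ 2) * (U3 y ^ 2 * ‖h0 y‖ ^ 2) ≤
        (1 / (2 * k * η ^ 2) * S) * (y * U3 y ^ 2) := by
      calc _ ≤ 1 / (2 * k * η ^ 2) * (U3 y ^ 2 * (y * S)) := by gcongr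
        _ = _ := by ring
    linarith
  have hLc : Continuous (fun y => ‖h1 y‖ ^ 2 * (3/4 - C1 / k) + c * ‖h2 y‖ ^ 2
      - (1 / (2 * k * η ^ 2) * S) * (y * U3 y ^ 2) - ‖f y‖ ^ 2 / η ^ 4) := by fun_prop
  have hintegr := intervalIntegral.integral_mono_on (μ := volume) hN
    (hLc.intervalIntegrable 0 N) (hB'c.intervalIntegrable 0 N) hpt
  rw [hFTC] at hintegr
  rw [intervalIntegral.integral_sub, intervalIntegral.integral_sub, intervalIntegral.integral_add,
    intervalIntegral.integral_mul_const, intervalIntegral.integral_const_mul,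
    intervalIntegral.integral_const_mul, intervalIntegral.integral_div, ← hS] at hintegr
  rotate_left
  all_goals try exact Continuous.intervalIntegrable (by fun_prop) _ _
  have h3' : (1 / (2 * k * η ^ 2) * S) * (∫ y in (0:ℝ)..N, y * U3 y ^ 2) ≤
      (1 / (2 * k * η ^ 2) * S) * M3 := by
    have := hU3 N hN
    gcongr
  have h4 : S * (3/4 - C1/k) - (1 / (2 * k * η ^ 2) * S) * M3 =
      S * (3/4 - (C1 + M3 / (2 * η ^ 2)) / k) := by field_simp; ring
  have h5 : (C1 + M3 / (2 * η ^ 2)) / k ≤ 1/4 := by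
    rw [div_le_iff₀ hk]; linarith
  have h6 : S * (1/2) ≤ S * (3/4 - (C1 + M3 / (2 * η ^ 2)) / k) := by
    apply mul_le_mul_of_nonneg_left _ hS0
    linarith
  linarith

/-- If `c G ≤ |flux|` with `h1` bounded then everything vanishes (Riccati blow-up). -/
lemma riccati_zero {G g : ℝ → ℝ} (hd : ∀ y, HasDerivAt G (g y) y)
    (hG0 : ∀ y, 0 ≤ y → 0 ≤ G y)
    {C : ℝ} (hC : 0 < C) (hineq : ∀ y, 0 ≤ y → G y ^ 2 ≤ C * g y) (y : ℝ) (hy : 0 ≤ y) : G y = 0 := by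
  by_contra hne
  have hpos : 0 < G y := lt_of_le_of_ne (hG0 y hy) (Ne.symm hne)
  have hgnn : ∀ z, 0 ≤ z → 0 ≤ g z := fun z hz => by
    have := (sq_nonneg _).trans (hineq z hz)
    by_contra h
    push Not at h
    nlinarith
  have hmono : MonotoneOn G (Ici 0) := by
    refine monotoneOn_of_deriv_nonneg (convex_Ici 0) (fun z _ => (hd z).continuousAt.continuousWithinAt)
      (fun z _ => (hd z).differentiableAt.differentiableWithinAt) ?_
    intro z hz
    rw [interior_Ici] at hz
    rw [(hd z).deriv]; exact hgnn z (le_of_lt hz)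
  have hGp : ∀ z, y ≤ z → 0 < G z := fun z hz =>
    lt_of_lt_of_le hpos (hmono hy (hy.trans hz) hz)
  have hQ : ∀ z, y ≤ z → HasDerivAt (fun z => -(G z)⁻¹ - z / C) (g z / G z ^ 2 - 1 / C) z := by
    intro z hz
    have h1 := ((hd z).fun_inv (hGp z hz).ne').fun_neg
    have h2 := h1.fun_sub ((hasDerivAt_id z).div_const C)
    refine h2.congr_deriv ?_
    ring
  have hmono2 : MonotoneOn (fun z => -(G z)⁻¹ - z / C) (Ici y) := by
    refine monotoneOn_of_deriv_nonneg (convex_Ici y)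
      (fun z hz => (hQ z hz).continuousAt.continuousWithinAt)
      (fun z hz => (hQ z (by rw [interior_Ici] at hz; exact le_of_lt hz)).differentiableAt.differentiableWithinAt) ?_
    intro z hz
    rw [interior_Ici] at hz
    have hz' : y ≤ z := le_of_lt hz
    rw [(hQ z hz').deriv, sub_nonneg, div_le_div_iff₀ hC (by have := hGp z hz'; positivity)]
    linarith [hineq z (hy.trans hz')]
  have hz : y ≤ y + C * (G y)⁻¹ := by
    have : 0 < C * (G y)⁻¹ := by positivity
    linarith
  have := hmono2 (le_refl y) hz hz
  simp only at this
  have h3 : (y + C * (G y)⁻¹) / C = y / C + (G y)⁻¹ := by field_simp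
  rw [h3] at this
  have h4 : 0 < (G (y + C * (G y)⁻¹))⁻¹ := inv_pos.2 (hGp _ hz)
  linarith
end Energy2


section IVP3

/-- third order scalar IVP, entire in the parameter -/
lemma ivp3 (U U1 : ℝ → ℝ) (hU : Continuous U) (hU1 : Continuous U1) (c : ℂ) (g : ℝ → ℂ)
    (hg : Continuous g) (a0 a1 a2 : ℂ) :
    ∃ P P1 P2 : ℂ → ℝ → ℂ,
      (∀ μ, P μ 0 = a0 ∧ P1 μ 0 = a1 ∧ P2 μ 0 = a2) ∧
      (∀ μ t, HasDerivAt (P μ) (P1 μ t) t) ∧ (∀ μ t, HasDerivAt (P1 μ) (P2 μ t) t) ∧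
      (∀ μ t, HasDerivAt (P2 μ) (c * ((μ - U t) * P1 μ t + U1 t * P μ t - g t)) t) ∧
      (∀ t, Differentiable ℂ fun μ => P μ t) ∧ (∀ t, Differentiable ℂ fun μ => P1 μ t) ∧
      (∀ t, Differentiable ℂ fun μ => P2 μ t) := by
  let p0 : (ℂ × ℂ × ℂ) →L[ℂ] ℂ := ContinuousLinearMap.fst ℂ ℂ (ℂ × ℂ)
  let p1 : (ℂ × ℂ × ℂ) →L[ℂ] ℂ := (ContinuousLinearMap.fst ℂ ℂ ℂ).comp
    (ContinuousLinearMap.snd ℂ ℂ (ℂ × ℂ))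
  let p2 : (ℂ × ℂ × ℂ) →L[ℂ] ℂ := (ContinuousLinearMap.snd ℂ ℂ ℂ).comp
    (ContinuousLinearMap.snd ℂ ℂ (ℂ × ℂ))
  let L0 : (ℂ × ℂ × ℂ) →L[ℂ] (ℂ × ℂ × ℂ) := p1.prod (p2.prod 0)
  let L1 : (ℂ × ℂ × ℂ) →L[ℂ] (ℂ × ℂ × ℂ) := (0 : (ℂ × ℂ × ℂ) →L[ℂ] ℂ).prod
    ((0 : (ℂ × ℂ × ℂ) →L[ℂ] ℂ).prod p1)
  let L2 : (ℂ × ℂ × ℂ) →L[ℂ] (ℂ × ℂ × ℂ) := (0 : (ℂ × ℂ × ℂ) →L[ℂ] ℂ).prod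
    ((0 : (ℂ × ℂ × ℂ) →L[ℂ] ℂ).prod p0)
  obtain ⟨X, hX0, hXd, hXμ⟩ := linear_ivp
    (fun t => L0 + (-(c * (U t : ℂ))) • L1 + (c * (U1 t : ℂ)) • L2)
    (fun _ => c • L1) (fun t => ((0 : ℂ), (0 : ℂ), -(c * g t))) (a0, a1, a2)
    (by fun_prop) (by fun_prop) (by fun_prop)
  refine ⟨fun μ t => p0 (X μ t), fun μ t => p1 (X μ t), fun μ t => p2 (X μ t), ?_, ?_, ?_, ?_,
    ?_, ?_, ?_⟩
  · intro μ; simp [p0, p1, p2, hX0]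
  · intro μ t
    have := (p0.restrictScalars ℝ).hasFDerivAt.comp_hasDerivAt t (hXd μ t)
    refine this.congr_deriv ?_
    simp [p0, p1, p2, L0, L1, L2]
  · intro μ t
    have := (p1.restrictScalars ℝ).hasFDerivAt.comp_hasDerivAt t (hXd μ t)
    refine this.congr_deriv ?_
    simp [p0, p1, p2, L0, L1, L2]
  · intro μ t
    have := (p2.restrictScalars ℝ).hasFDerivAt.comp_hasDerivAt t (hXd μ t)
    refine this.congr_deriv ?_
    simp [p0, p1, p2, L0, L1, L2]
    ring
  · intro t; exact p0.differentiable.comp (hXμ t)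
  · intro t; exact p1.differentiable.comp (hXμ t)
  · intro t; exact p2.differentiable.comp (hXμ t)

end IVP3

section HTrans

/-- the `h` variable: `h = φ/(μ-U)` and its derivatives -/
noncomputable def hv0 (U : ℝ → ℝ) (μ : ℂ) (φ : ℝ → ℂ) (y : ℝ) : ℂ := φ y / (μ - U y)
/-- first derivative of `h` -/
noncomputable def hv1 (U U1 : ℝ → ℝ) (μ : ℂ) (φ φ1 : ℝ → ℂ) (y : ℝ) : ℂ :=
  (φ1 y + U1 y * hv0 U μ φ y) / (μ - U y)
/-- second derivative of `h` -/
noncomputable def hv2 (U U1 U2 : ℝ → ℝ) (μ : ℂ) (φ φ1 φ2 : ℝ → ℂ) (y : ℝ) : ℂ :=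
  (φ2 y + 2 * U1 y * hv1 U U1 μ φ φ1 y + U2 y * hv0 U μ φ y) / (μ - U y)
/-- third derivative of `h` -/
noncomputable def hv3 (U U1 U2 U3 : ℝ → ℝ) (μ : ℂ) (φ φ1 φ2 φ3 : ℝ → ℂ) (y : ℝ) : ℂ :=
  (φ3 y + 3 * U1 y * hv2 U U1 U2 μ φ φ1 φ2 y + 3 * U2 y * hv1 U U1 μ φ φ1 y
    + U3 y * hv0 U μ φ y) / (μ - U y)

variable {U U1 U2 U3 : ℝ → ℝ} {μ : ℂ} {φ φ1 φ2 φ3 : ℝ → ℂ}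

lemma hv0_deriv (hμ : 0 < μ.im) (hU : ∀ y, HasDerivAt U (U1 y) y)
    (hφ : ∀ y, HasDerivAt φ (φ1 y) y) (y : ℝ) :
    HasDerivAt (hv0 U μ φ) (hv1 U U1 μ φ φ1 y) y := by
  have hm := sub_ne_zero_of_im hμ (U y)
  have hden : HasDerivAt (fun y => μ - (U y : ℂ)) (-(U1 y : ℂ)) y :=
    ((hU y).ofReal_comp).const_sub μ
  refine ((hφ y).fun_div hden hm).congr_deriv ?_
  simp only [hv1, hv0]
  field_simp
  ring

lemma hv1_deriv (hμ : 0 < μ.im) (hU : ∀ y, HasDerivAt U (U1 y) y)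
    (hU1 : ∀ y, HasDerivAt U1 (U2 y) y)
    (hφ : ∀ y, HasDerivAt φ (φ1 y) y) (hφ1 : ∀ y, HasDerivAt φ1 (φ2 y) y) (y : ℝ) :
    HasDerivAt (hv1 U U1 μ φ φ1) (hv2 U U1 U2 μ φ φ1 φ2 y) y := by
  have hm := sub_ne_zero_of_im hμ (U y)
  have hden : HasDerivAt (fun y => μ - (U y : ℂ)) (-(U1 y : ℂ)) y :=
    ((hU y).ofReal_comp).const_sub μ
  have h0 := hv0_deriv hμ hU hφ y
  refine (((hφ1 y).fun_add (((hU1 y).ofReal_comp).fun_mul h0)).fun_div hden hm).congr_deriv ?_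
  rw [hv2, div_eq_div_iff (pow_ne_zero 2 hm) hm]
  have : φ1 y + U1 y * hv0 U μ φ y = hv1 U U1 μ φ φ1 y * (μ - U y) := by
    rw [hv1, div_mul_cancel₀ _ hm]
  rw [this]; ring

lemma hv2_deriv (hμ : 0 < μ.im) (hU : ∀ y, HasDerivAt U (U1 y) y)
    (hU1 : ∀ y, HasDerivAt U1 (U2 y) y) (hU2 : ∀ y, HasDerivAt U2 (U3 y) y)
    (hφ : ∀ y, HasDerivAt φ (φ1 y) y) (hφ1 : ∀ y, HasDerivAt φ1 (φ2 y) y)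
    (hφ2 : ∀ y, HasDerivAt φ2 (φ3 y) y) (y : ℝ) :
    HasDerivAt (hv2 U U1 U2 μ φ φ1 φ2) (hv3 U U1 U2 U3 μ φ φ1 φ2 φ3 y) y := by
  have hm := sub_ne_zero_of_im hμ (U y)
  have hden : HasDerivAt (fun y => μ - (U y : ℂ)) (-(U1 y : ℂ)) y :=
    ((hU y).ofReal_comp).const_sub μ
  have h0 := hv0_deriv hμ hU hφ y
  have h1 := hv1_deriv hμ hU hU1 hφ hφ1 y
  refine ((((hφ2 y).fun_add (((hU1 y).ofReal_comp.const_mul 2).fun_mul h1)).fun_add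
    (((hU2 y).ofReal_comp).fun_mul h0)).fun_div hden hm).congr_deriv ?_
  rw [hv3, div_eq_div_iff (pow_ne_zero 2 hm) hm]
  have : φ2 y + 2 * U1 y * hv1 U U1 μ φ φ1 y + U2 y * hv0 U μ φ y =
      hv2 U U1 U2 μ φ φ1 φ2 y * (μ - U y) := by
    rw [hv2, div_mul_cancel₀ _ hm]
  rw [this]; ring

lemma hv3_continuous (hμ : 0 < μ.im) (hU : ∀ y, HasDerivAt U (U1 y) y)
    (hU1 : ∀ y, HasDerivAt U1 (U2 y) y) (hU2 : ∀ y, HasDerivAt U2 (U3 y) y) (hU3 : Continuous U3)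
    (hφ : ∀ y, HasDerivAt φ (φ1 y) y) (hφ1 : ∀ y, HasDerivAt φ1 (φ2 y) y)
    (hφ2 : ∀ y, HasDerivAt φ2 (φ3 y) y) (hφ3 : Continuous φ3) :
    Continuous (hv3 U U1 U2 U3 μ φ φ1 φ2 φ3) := by
  have c0 : Continuous (hv0 U μ φ) :=
    continuous_iff_continuousAt.2 fun y => (hv0_deriv hμ hU hφ y).continuousAt
  have c1 : Continuous (hv1 U U1 μ φ φ1) :=
    continuous_iff_continuousAt.2 fun y => (hv1_deriv hμ hU hU1 hφ hφ1 y).continuousAt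
  have c2 : Continuous (hv2 U U1 U2 μ φ φ1 φ2) :=
    continuous_iff_continuousAt.2 fun y => (hv2_deriv hμ hU hU1 hU2 hφ hφ1 hφ2 y).continuousAt
  have cU : Continuous U := continuous_iff_continuousAt.2 fun y => (hU y).continuousAt
  have cU1 : Continuous U1 := continuous_iff_continuousAt.2 fun y => (hU1 y).continuousAt
  have cU2 : Continuous U2 := continuous_iff_continuousAt.2 fun y => (hU2 y).continuousAt
  refine Continuous.div ?_ (by fun_prop) (fun y => sub_ne_zero_of_im hμ (U y))
  fun_prop

lemma hv_ode (hμ : 0 < μ.im) {k : ℂ} {f : ℂ} {y : ℝ}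
    (h : (μ - U y) * φ1 y + U1 y * φ y - Complex.I / k * φ3 y = f) :
    (μ - U y) ^ 2 * hv1 U U1 μ φ φ1 y - Complex.I / k *
      ((μ - U y) * hv3 U U1 U2 U3 μ φ φ1 φ2 φ3 y - 3 * U1 y * hv2 U U1 U2 μ φ φ1 φ2 y
        - 3 * U2 y * hv1 U U1 μ φ φ1 y - U3 y * hv0 U μ φ y) = f := by
  have hm := sub_ne_zero_of_im hμ (U y)
  have e3 : (μ - U y) * hv3 U U1 U2 U3 μ φ φ1 φ2 φ3 y = φ3 y + 3 * U1 y * hv2 U U1 U2 μ φ φ1 φ2 y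
      + 3 * U2 y * hv1 U U1 μ φ φ1 y + U3 y * hv0 U μ φ y := by
    rw [hv3, mul_div_cancel₀ _ hm]
  have e1 : (μ - U y) * hv1 U U1 μ φ φ1 y = φ1 y + U1 y * hv0 U μ φ y := by
    rw [hv1, mul_div_cancel₀ _ hm]
  have e0 : (μ - U y) * hv0 U μ φ y = φ y := by
    rw [hv0, mul_div_cancel₀ _ hm]
  rw [e3, ← h, ← e0]
  have : φ1 y = (μ - U y) * hv1 U U1 μ φ φ1 y - U1 y * hv0 U μ φ y := by rw [e1]; ring
  rw [this]
  ring

end HTrans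


/-- Quantitative facts on the shear flow used in the proof. -/
structure Prof (U U1 U2 U3 : ℝ → ℝ) (M M3 B B2 B3 : ℝ) : Prop where
  d0 : ∀ y, HasDerivAt U (U1 y) y
  d1 : ∀ y, HasDerivAt U1 (U2 y) y
  d2 : ∀ y, HasDerivAt U2 (U3 y) y
  c3 : Continuous U3
  bU : ∀ y, 0 ≤ y → |U y| ≤ 1
  b1 : ∀ y, 0 ≤ y → |U1 y| ≤ M
  b2 : ∀ y, 0 ≤ y → |U2 y| ≤ M
  b3 : ∀ N, 0 ≤ N → ∫ y in (0:ℝ)..N, y * U3 y ^ 2 ≤ M3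
  w1 : ∀ y, 0 ≤ y → |(1 + y) * U1 y| ≤ B
  t1 : Tendsto (fun y => (1 + y) * U1 y) atTop (nhds 0)
  i0 : ∀ N, 0 ≤ N → ∫ y in (0:ℝ)..N, (1 - U y) ^ 2 ≤ B2
  i1 : ∀ N, 0 ≤ N → ∫ y in (0:ℝ)..N, ((1 + y) * U1 y) ^ 2 ≤ B3

lemma intervalIntegral_le_Ioi {g : ℝ → ℝ} (hg : IntegrableOn g (Ioi 0))
    (h0 : ∀ y, 0 < y → 0 ≤ g y) {N : ℝ} (hN : 0 ≤ N) :
    ∫ y in (0:ℝ)..N, g y ≤ ∫ y in Ioi (0:ℝ), g y := by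
  rw [intervalIntegral.integral_of_le hN]
  refine setIntegral_mono_set hg ?_ (Eventually.of_forall Ioc_subset_Ioi_self)
  filter_upwards [self_mem_ae_restrict measurableSet_Ioi] with y hy using h0 y hy

lemma integrableOn_sq_of_weight {g ω : ℝ → ℝ} (hg : Continuous g) (hω : ∀ y, 0 ≤ y → 1 ≤ ω y)
    (h : IntegrableOn (fun y => g y ^ 2 * ω y) (Ioi 0)) :
    IntegrableOn (fun y => g y ^ 2) (Ioi 0) := by
  refine Integrable.mono' h (Continuous.aestronglyMeasurable (by fun_prop)) ?_
  filter_upwards [self_mem_ae_restrict measurableSet_Ioi] with y hy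
  rw [Real.norm_of_nonneg (sq_nonneg _)]
  have := hω y (le_of_lt hy)
  nlinarith [sq_nonneg (g y)]

lemma exists_prof {U ω : ℝ → ℝ}
    (hU : AdmissibleShearFlow U) (hω : WeightFn ω) (hdec : WeightedDecay U ω) :
    ∃ M M3 B B2 B3 : ℝ, 0 ≤ M ∧ 0 ≤ M3 ∧ 0 ≤ B ∧ 0 ≤ B2 ∧ 0 ≤ B3 ∧
      Prof U (deriv U) (iteratedDeriv 2 U) (iteratedDeriv 3 U) M M3 B B2 B3 := by
  obtain ⟨hd0, hdj⟩ := hdec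
  have hit1 : iteratedDeriv 1 U = deriv U := iteratedDeriv_one
  have hD : ∀ n : ℕ, ∀ y, HasDerivAt (iteratedDeriv n U) (iteratedDeriv (n+1) U y) y := by
    intro n y
    rw [iteratedDeriv_succ]
    have : Differentiable ℝ (iteratedDeriv n U) :=
      hU.smooth.differentiable_iteratedDeriv n (by exact_mod_cast WithTop.coe_lt_top _)
    exact (this y).hasDerivAt
  have hC : ∀ n : ℕ, Continuous (iteratedDeriv n U) := fun n =>
    continuous_iff_continuousAt.2 fun y => (hD n y).continuousAt
  have hUc : Continuous U := hU.smooth.continuous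
  obtain ⟨M₁, hM₁⟩ := hU.derivs_bounded 1 (by norm_num) (by norm_num)
  obtain ⟨M₂, hM₂⟩ := hU.derivs_bounded 2 (by norm_num) (by norm_num)
  have I0 := integrableOn_sq_of_weight (g := fun y => 1 - U y) (by fun_prop) hω.one_le hd0
  have IJ : ∀ j : ℕ, 1 ≤ j → j ≤ 3 →
    IntegrableOn (fun y => ((1 + y) * iteratedDeriv j U y) ^ 2) (Ioi (0:ℝ)) := fun j h1 h3 => by
      have := hC j
      exact integrableOn_sq_of_weight (g := fun y => (1 + y) * iteratedDeriv j U y)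
        (by fun_prop) hω.one_le (hdj j h1 h3)
  have I1 := IJ 1 (by norm_num) (by norm_num)
  have I2 := IJ 2 (by norm_num) (by norm_num)
  have I3 := IJ 3 (by norm_num) (by norm_num)
  rw [hit1] at hM₁ I1
  have c1 := hC 1
  rw [hit1] at c1
  have c2 := hC 2
  have c3 := hC 3
  have d1 : ∀ y, HasDerivAt (deriv U) (iteratedDeriv 2 U y) y := by
    have := hD 1; rwa [hit1] at this
  have I3' : IntegrableOn (fun y => y * iteratedDeriv 3 U y ^ 2) (Ioi 0) := by
    refine Integrable.mono' I3 (Continuous.aestronglyMeasurable (by fun_prop)) ?_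
    filter_upwards [self_mem_ae_restrict measurableSet_Ioi] with y hy
    have hy' : (0:ℝ) < y := hy
    rw [Real.norm_of_nonneg (by positivity), mul_pow]
    gcongr
    nlinarith
  -- decay of (1+y) U'
  have hsq : ∀ y, HasDerivAt (fun y => ((1 + y) * deriv U y) ^ 2)
      (2 * ((1 + y) * deriv U y) * (deriv U y + (1 + y) * iteratedDeriv 2 U y)) y := by
    intro y
    refine ((((hasDerivAt_id y).const_add 1).fun_mul (d1 y)).fun_pow 2).congr_deriv ?_
    simp
  have hsqi : IntegrableOn (fun y => 2 * ((1 + y) * deriv U y) *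
      (deriv U y + (1 + y) * iteratedDeriv 2 U y)) (Ioi 0) := by
    refine Integrable.mono' ((I1.const_mul 3).add (I2.const_mul 2))
      (Continuous.aestronglyMeasurable (by fun_prop)) ?_
    filter_upwards [self_mem_ae_restrict measurableSet_Ioi] with y hy
    have hy' : (0:ℝ) < y := hy
    simp only [Pi.add_apply]
    have h1 : deriv U y ^ 2 ≤ ((1 + y) * deriv U y) ^ 2 := by
      rw [mul_pow]
      nlinarith [sq_nonneg (deriv U y), mul_nonneg hy'.le (sq_nonneg (deriv U y)),
        mul_nonneg (sq_nonneg y) (sq_nonneg (deriv U y))]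
    set a := (1 + y) * deriv U y
    set b := (1 + y) * iteratedDeriv 2 U y
    rw [Real.norm_eq_abs, abs_le]
    constructor <;> nlinarith [sq_nonneg (a + (deriv U y + b)), sq_nonneg (a - (deriv U y + b)),
      sq_nonneg (deriv U y - b)]
  have hlim := tendsto_zero_of_hasDerivAt_of_integrableOn_Ioi (fun y _ => hsq y) hsqi I1
  have hlim' : Tendsto (fun y => (1 + y) * deriv U y) atTop (nhds 0) := by
    have h := (Real.continuous_sqrt.tendsto 0).comp hlim
    rw [Real.sqrt_zero] at h
    rw [tendsto_zero_iff_abs_tendsto_zero]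
    refine h.congr fun y => ?_
    simp [Real.sqrt_sq_eq_abs]
  have hbd : ∃ B, 0 ≤ B ∧ ∀ y, 0 ≤ y → |(1 + y) * deriv U y| ≤ B := by
    have he : ∀ᶠ y in atTop, |(1 + y) * deriv U y| < 1 := by
      have := (tendsto_zero_iff_abs_tendsto_zero _).1 hlim'
      exact this.eventually (gt_mem_nhds one_pos)
    obtain ⟨A, hA⟩ := eventually_atTop.1 he
    obtain ⟨C, hC⟩ := (isCompact_Icc (a := (0:ℝ)) (b := A)).exists_bound_of_continuousOn
      (f := fun y => (1 + y) * deriv U y) (by fun_prop)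
    refine ⟨max 1 C, le_max_of_le_left zero_le_one, fun y hy => ?_⟩
    rcases le_total A y with h | h
    · exact (hA y h).le.trans (le_max_left _ _)
    · exact (hC y ⟨hy, h⟩).trans (le_max_right _ _)
  obtain ⟨B, hB0, hB⟩ := hbd
  refine ⟨max M₁ M₂, ∫ y in Ioi (0:ℝ), y * iteratedDeriv 3 U y ^ 2, B,
    ∫ y in Ioi (0:ℝ), (1 - U y) ^ 2, ∫ y in Ioi (0:ℝ), ((1 + y) * deriv U y) ^ 2, ?_, ?_, hB0, ?_, ?_, ?_⟩
  · exact le_max_of_le_left ((abs_nonneg _).trans (hM₁ 0 le_rfl))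
  · exact setIntegral_nonneg measurableSet_Ioi fun y hy => mul_nonneg (le_of_lt hy) (sq_nonneg _)
  · exact setIntegral_nonneg measurableSet_Ioi fun y hy => sq_nonneg _
  · exact setIntegral_nonneg measurableSet_Ioi fun y hy => sq_nonneg _
  · refine ⟨?_, d1, hD 2, c3, ?_, ?_, ?_, ?_, hB, hlim', ?_, ?_⟩
    · intro y
      have := hD 0 y
      simpa [iteratedDeriv_zero, hit1] using this
    · intro y hy
      have := hU.mem_Ico y hy
      rw [abs_of_nonneg this.1]; exact this.2.le
    · exact fun y hy => (hM₁ y hy).trans (le_max_left _ _)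
    · exact fun y hy => (hM₂ y hy).trans (le_max_right _ _)
    · exact fun N hN => intervalIntegral_le_Ioi I3'
        (fun y hy => mul_nonneg (le_of_lt hy) (sq_nonneg _)) hN
    · exact fun N hN => intervalIntegral_le_Ioi I0 (fun y hy => sq_nonneg _) hN
    · exact fun N hN => intervalIntegral_le_Ioi I1 (fun y hy => sq_nonneg _) hN


/-- `φ1,φ2,φ3` are the successive derivatives of `φ`. -/
structure Chain (φ φ1 φ2 φ3 : ℝ → ℂ) : Prop where
  d0 : ∀ y, HasDerivAt φ (φ1 y) y
  d1 : ∀ y, HasDerivAt φ1 (φ2 y) y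
  d2 : ∀ y, HasDerivAt φ2 (φ3 y) y
  c3 : Continuous φ3

/-- the threshold on `k` -/
noncomputable def Kthr (M M3 η : ℝ) : ℝ :=
  4 * (8 * M ^ 2 / η ^ 3 + 3 * M / η ^ 2 + 1 / (2 * η ^ 2) + M3 / (2 * η ^ 2))

section
variable {U U1 U2 U3 : ℝ → ℝ} {M M3 B B2 B3 : ℝ} {η k : ℝ} {μ : ℂ} {φ φ1 φ2 φ3 f : ℝ → ℂ}

lemma Prof.cU (hP : Prof U U1 U2 U3 M M3 B B2 B3) : Continuous U :=
  continuous_iff_continuousAt.2 fun y => (hP.d0 y).continuousAt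
lemma Prof.cU1 (hP : Prof U U1 U2 U3 M M3 B B2 B3) : Continuous U1 :=
  continuous_iff_continuousAt.2 fun y => (hP.d1 y).continuousAt
lemma Chain.cc0 (h : Chain φ φ1 φ2 φ3) : Continuous φ :=
  continuous_iff_continuousAt.2 fun y => (h.d0 y).continuousAt
lemma Chain.cc1 (h : Chain φ φ1 φ2 φ3) : Continuous φ1 :=
  continuous_iff_continuousAt.2 fun y => (h.d1 y).continuousAt
lemma Chain.cc2 (h : Chain φ φ1 φ2 φ3) : Continuous φ2 :=
  continuous_iff_continuousAt.2 fun y => (h.d2 y).continuousAt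

lemma Chain.hv (hP : Prof U U1 U2 U3 M M3 B B2 B3) (hμ : 0 < μ.im) (h : Chain φ φ1 φ2 φ3) :
    Chain (hv0 U μ φ) (hv1 U U1 μ φ φ1) (hv2 U U1 U2 μ φ φ1 φ2)
      (hv3 U U1 U2 U3 μ φ φ1 φ2 φ3) :=
  ⟨hv0_deriv hμ hP.d0 h.d0, hv1_deriv hμ hP.d0 hP.d1 h.d0 h.d1,
    hv2_deriv hμ hP.d0 hP.d1 hP.d2 h.d0 h.d1 h.d2,
    hv3_continuous hμ hP.d0 hP.d1 hP.d2 hP.c3 h.d0 h.d1 h.d2 h.c3⟩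

lemma energy_chain (hP : Prof U U1 U2 U3 M M3 B B2 B3) (hη : 0 < η) (hk : 0 < k)
    (hμ : η ≤ μ.im) (hkK : Kthr M M3 η ≤ k) (h : Chain φ φ1 φ2 φ3) (hf : Continuous f)
    (h0 : φ 0 = 0) (h1 : φ1 0 = 0)
    (hode : ∀ y, 0 ≤ y → (μ - U y) * φ1 y + U1 y * φ y - Complex.I / (k:ℂ) * φ3 y = f y)
    {N : ℝ} (hN : 0 ≤ N) :
    1 / 2 * (∫ y in (0:ℝ)..N, ‖hv1 U U1 μ φ φ1 y‖ ^ 2)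
      + η / (2 * k * (‖μ‖ + 1) ^ 2) * (∫ y in (0:ℝ)..N, ‖hv2 U U1 U2 μ φ φ1 φ2 y‖ ^ 2)
      ≤ flux U μ k (hv1 U U1 μ φ φ1) (hv2 U U1 U2 μ φ φ1 φ2) N
        + (∫ y in (0:ℝ)..N, ‖f y‖ ^ 2) / η ^ 4 := by
  have hτ : 0 < μ.im := hη.trans_le hμ
  have hc := h.hv hP hτ
  have e00 : hv0 U μ φ 0 = 0 := by simp [hv0, h0]
  have e10 : hv1 U U1 μ φ φ1 0 = 0 := by simp [hv1, h1, e00]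
  have := energy_integrated hη hk hμ hkK hP.d0 hP.cU1 hP.c3 hP.bU hP.b1 hP.b2 hP.b3 hc.d0 hc.d1
    hc.d2 hc.c3 hf e00 (fun y hy => hv_ode (φ2 := φ2) hτ (hode y hy)) hN
  have e : flux U μ k (hv1 U U1 μ φ φ1) (hv2 U U1 U2 μ φ φ1 φ2) 0 = 0 := by
    simp [flux, e10]
  rw [e, sub_zero] at this
  exact this

lemma flux_le (hη : 0 < η) (hk : 0 < k) (hμ : η ≤ μ.im) (h1 h2 : ℝ → ℂ) (y : ℝ) :
    flux U μ k h1 h2 y ≤ ‖h1 y‖ * ‖h2 y‖ / (k * η) := by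
  have hτ : 0 < μ.im := hη.trans_le hμ
  refine (Complex.re_le_norm _).trans ?_
  rw [norm_mul, norm_div, norm_div, norm_mul, Complex.norm_I, Complex.norm_conj,
    Complex.norm_real, Real.norm_of_nonneg hk.le, div_mul_div_comm, one_mul,
    mul_comm ‖h1 y‖]
  have : η ≤ ‖μ - (U y:ℂ)‖ := hμ.trans (im_le_norm_sub _)
  gcongr

lemma hv1_zero_imp (hP : Prof U U1 U2 U3 M M3 B B2 B3) (hμ : 0 < μ.im)
    (h : Chain φ φ1 φ2 φ3) (h0 : φ 0 = 0) {y : ℝ} (hy : 0 ≤ y)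
    (hI : ∫ y in (0:ℝ)..y, ‖hv1 U U1 μ φ φ1 y‖ ^ 2 ≤ 0) : φ y = 0 := by
  have hc := h.hv hP hμ
  have e00 : hv0 U μ φ 0 = 0 := by simp [hv0, h0]
  have h1 := norm_sq_le_of_primitive hc.d0 hc.cc1 e00 hy
  have h2 : ‖hv0 U μ φ y‖ ^ 2 ≤ 0 := h1.trans (mul_nonpos_of_nonneg_of_nonpos hy hI)
  have h3 : hv0 U μ φ y = 0 := by
    rw [← norm_eq_zero]; exact pow_eq_zero_iff two_ne_zero |>.1 (le_antisymm h2 (sq_nonneg _))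
  rw [hv0, div_eq_zero_iff] at h3
  exact h3.resolve_right (sub_ne_zero_of_im hμ _)

lemma bdd_of_tendsto {E : Type*} [NormedAddCommGroup E] {g : ℝ → E} (hc : Continuous g)
    (ht : Tendsto g atTop (nhds 0)) :
    ∃ D, 0 ≤ D ∧ ∀ y, 0 ≤ y → ‖g y‖ ≤ D := by
  have he : ∀ᶠ y in atTop, ‖g y‖ < 1 := by
    have := (tendsto_zero_iff_norm_tendsto_zero).1 ht
    exact this.eventually (gt_mem_nhds one_pos)
  obtain ⟨A, hA⟩ := eventually_atTop.1 he
  obtain ⟨C, hC⟩ := (isCompact_Icc (a := (0:ℝ)) (b := A)).exists_bound_of_continuousOn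
    (f := g) hc.continuousOn
  refine ⟨max 1 C, le_max_of_le_left zero_le_one, fun y hy => ?_⟩
  rcases le_total A y with h | h
  · exact (hA y h).le.trans (le_max_left _ _)
  · exact (hC y ⟨hy, h⟩).trans (le_max_right _ _)

lemma uniq_zero (hP : Prof U U1 U2 U3 M M3 B B2 B3) (hη : 0 < η) (hk : 0 < k)
    (hμ : η ≤ μ.im) (hkK : Kthr M M3 η ≤ k) (h : Chain φ φ1 φ2 φ3)
    (h0 : φ 0 = 0) (h1 : φ1 0 = 0) (ht : Tendsto φ1 atTop (nhds 0))
    (hode : ∀ y, 0 ≤ y → (μ - U y) * φ1 y + U1 y * φ y - Complex.I / (k:ℂ) * φ3 y = 0)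
    {y : ℝ} (hy : 0 ≤ y) : φ y = 0 := by
  have hτ : 0 < μ.im := hη.trans_le hμ
  have hc := h.hv hP hτ
  obtain ⟨D, hD0, hD⟩ := bdd_of_tendsto h.cc1 ht
  have hB0 : 0 ≤ B := (abs_nonneg _).trans (hP.w1 0 le_rfl)
  have hφ : ∀ y, 0 ≤ y → ‖φ y‖ ≤ D * y := by
    intro y hy
    have := norm_image_sub_le_of_norm_deriv_le_segment' (f := φ) (f' := φ1) (a := 0) (b := y) (C := D)
      (fun x _ => (h.d0 x).hasDerivWithinAt) (fun x hx => hD x hx.1) y ⟨hy, le_rfl⟩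
    simpa [h0] using this
  have hmη : ∀ y : ℝ, η ≤ ‖μ - (U y:ℂ)‖ := fun y => hμ.trans (im_le_norm_sub _)
  set Mh := (D + B * D / η) / η with hMh
  have hMh0 : 0 ≤ Mh := by positivity
  have hh1 : ∀ y, 0 ≤ y → ‖hv1 U U1 μ φ φ1 y‖ ≤ Mh := by
    intro y hy
    rw [hv1, norm_div]
    refine div_le_div₀ (by positivity) ?_ hη (hmη y)
    refine (norm_add_le _ _).trans (add_le_add (hD y hy) ?_)
    rw [norm_mul, hv0, norm_div, Complex.norm_real, Real.norm_eq_abs]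
    calc |U1 y| * (‖φ y‖ / ‖μ - (U y:ℂ)‖) ≤ |U1 y| * (D * y / η) := by
          gcongr
          · exact hφ y hy
          · exact hmη y
      _ ≤ |U1 y| * (D * (1 + y) / η) := by gcongr; linarith
      _ = |(1 + y) * U1 y| * D / η := by
          rw [abs_mul, abs_of_nonneg (by linarith : (0:ℝ) ≤ 1 + y)]; ring
      _ ≤ B * D / η := by gcongr; exact hP.w1 y hy
  set g : ℝ → ℝ := fun y => ‖hv1 U U1 μ φ φ1 y‖ ^ 2 + ‖hv2 U U1 U2 μ φ φ1 φ2 y‖ ^ 2 with hg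
  have c1 := hc.cc1
  have c2 := hc.cc2
  have hgc : Continuous g := by fun_prop
  set G : ℝ → ℝ := fun y => ∫ s in (0:ℝ)..y, g s with hG
  have hGd : ∀ y, HasDerivAt G (g y) y := fun y =>
    intervalIntegral.integral_hasDerivAt_right (hgc.intervalIntegrable _ _)
      hgc.aestronglyMeasurable.stronglyMeasurableAtFilter hgc.continuousAt
  have hG0 : ∀ y, 0 ≤ y → 0 ≤ G y := fun y hy =>
    intervalIntegral.integral_nonneg hy fun s _ => by positivity
  set c := η / (2 * k * (‖μ‖ + 1) ^ 2) with hcdef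
  have hcpos : 0 < c := by positivity
  set c' := min (1/2) c with hc'
  have hc'pos : 0 < c' := lt_min (by norm_num) hcpos
  have hGe : ∀ y, G y = (∫ s in (0:ℝ)..y, ‖hv1 U U1 μ φ φ1 s‖ ^ 2)
      + ∫ s in (0:ℝ)..y, ‖hv2 U U1 U2 μ φ φ1 φ2 s‖ ^ 2 := fun y =>
    intervalIntegral.integral_add (Continuous.intervalIntegrable (by fun_prop) _ _)
      (Continuous.intervalIntegrable (by fun_prop) _ _)
  have hin : ∀ y, 0 ≤ y → c' * G y ≤ Mh * ‖hv2 U U1 U2 μ φ φ1 φ2 y‖ / (k * η) := by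
    intro y hy
    have he := energy_chain (f := fun _ => 0) hP hη hk hμ hkK h continuous_const h0 h1 hode hy
    simp only [norm_zero, ne_eq, OfNat.ofNat_ne_zero, not_false_eq_true, zero_pow,
      intervalIntegral.integral_zero, zero_div, add_zero] at he
    have hfl := flux_le (U := U) hη hk hμ (hv1 U U1 μ φ φ1) (hv2 U U1 U2 μ φ φ1 φ2) y
    have hI1 : 0 ≤ ∫ s in (0:ℝ)..y, ‖hv1 U U1 μ φ φ1 s‖ ^ 2 :=
      intervalIntegral.integral_nonneg hy fun s _ => by positivity
    have hI2 : 0 ≤ ∫ s in (0:ℝ)..y, ‖hv2 U U1 U2 μ φ φ1 φ2 s‖ ^ 2 :=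
      intervalIntegral.integral_nonneg hy fun s _ => by positivity
    have a1 := mul_le_mul_of_nonneg_right (min_le_left (1/2) c) hI1
    have a2 := mul_le_mul_of_nonneg_right (min_le_right (1/2) c) hI2
    have a3 : ‖hv1 U U1 μ φ φ1 y‖ * ‖hv2 U U1 U2 μ φ φ1 φ2 y‖ / (k * η) ≤
        Mh * ‖hv2 U U1 U2 μ φ φ1 φ2 y‖ / (k * η) := by
      gcongr; exact hh1 y hy
    rw [hGe, mul_add]
    linarith
  have hGz := riccati_zero hGd hG0 (C := (Mh / (k * η * c')) ^ 2 + 1) (by positivity) (fun y hy => by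
    have h1 := hin y hy
    have h2 : G y ≤ Mh / (k * η * c') * ‖hv2 U U1 U2 μ φ φ1 φ2 y‖ := by
      rw [← mul_le_mul_iff_right₀ hc'pos]
      refine h1.trans (le_of_eq ?_)
      field_simp
    calc G y ^ 2 ≤ (Mh / (k * η * c') * ‖hv2 U U1 U2 μ φ φ1 φ2 y‖) ^ 2 :=
          pow_le_pow_left₀ (hG0 y hy) h2 2
      _ = (Mh / (k * η * c')) ^ 2 * ‖hv2 U U1 U2 μ φ φ1 φ2 y‖ ^ 2 := by ring
      _ ≤ ((Mh / (k * η * c')) ^ 2 + 1) * g y := by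
          have : ‖hv2 U U1 U2 μ φ φ1 φ2 y‖ ^ 2 ≤ g y := le_add_of_nonneg_left (sq_nonneg _)
          have h0 : 0 ≤ g y := by positivity
          nlinarith [sq_nonneg (Mh / (k * η * c'))]) y hy
  refine hv1_zero_imp hP hτ h h0 hy ?_
  have hI2 : 0 ≤ ∫ s in (0:ℝ)..y, ‖hv2 U U1 U2 μ φ φ1 φ2 s‖ ^ 2 :=
      intervalIntegral.integral_nonneg hy fun s _ => by positivity
  have := hGe y
  linarith
end


section
variable {U U1 U2 U3 : ℝ → ℝ} {M M3 B B2 B3 : ℝ} {η k : ℝ} {μ : ℂ} {φ φ1 φ2 φ3 f : ℝ → ℂ}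
  {p p1 p2 p3 q q1 q2 q3 : ℝ → ℂ}

lemma Chain.comb (hp : Chain p p1 p2 p3) (hq : Chain q q1 q2 q3) (a : ℂ) :
    Chain (fun y => p y + a * q y) (fun y => p1 y + a * q1 y) (fun y => p2 y + a * q2 y)
      (fun y => p3 y + a * q3 y) where
  d0 y := (hp.d0 y).fun_add ((hq.d0 y).const_mul a)
  d1 y := (hp.d1 y).fun_add ((hq.d1 y).const_mul a)
  d2 y := (hp.d2 y).fun_add ((hq.d2 y).const_mul a)
  c3 := by have := hp.c3; have := hq.c3; fun_prop

lemma hv1_comb (a : ℂ) (y : ℝ) :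
    hv1 U U1 μ (fun y => p y + a * q y) (fun y => p1 y + a * q1 y) y =
      hv1 U U1 μ p p1 y + a * hv1 U U1 μ q q1 y := by
  simp only [hv1, hv0]; ring

lemma hv2_comb (a : ℂ) (y : ℝ) :
    hv2 U U1 U2 μ (fun y => p y + a * q y) (fun y => p1 y + a * q1 y)
      (fun y => p2 y + a * q2 y) y =
      hv2 U U1 U2 μ p p1 p2 y + a * hv2 U U1 U2 μ q q1 q2 y := by
  simp only [hv2, hv1, hv0]; ring

lemma tendsto_of_bdd (hP : Prof U U1 U2 U3 M M3 B B2 B3) (hμ : 0 < μ.im)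
    (h : Chain φ φ1 φ2 φ3) (h0 : φ 0 = 0) {C : ℝ}
    (hI : ∀ N, 0 ≤ N → ∫ y in (0:ℝ)..N,
      (‖hv1 U U1 μ φ φ1 y‖ ^ 2 + ‖hv2 U U1 U2 μ φ φ1 φ2 y‖ ^ 2) ≤ C) :
    Tendsto φ1 atTop (nhds 0) := by
  have hc := h.hv hP hμ
  have c1 := hc.cc1
  have c2 := hc.cc2
  have e00 : hv0 U μ φ 0 = 0 := by simp [hv0, h0]
  have hC0 : 0 ≤ C := by simpa using hI 0 le_rfl
  set h1 := hv1 U U1 μ φ φ1 with hh1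
  set h2 := hv2 U U1 U2 μ φ φ1 φ2 with hh2
  have hsum : IntegrableOn (fun y => ‖h1 y‖ ^ 2 + ‖h2 y‖ ^ 2) (Ioi 0) := by
    refine integrableOn_Ioi_of_intervalIntegral_norm_bounded (l := atTop) (b := id) C 0
      (fun N => (Continuous.integrableOn_Ioc (by fun_prop))) tendsto_id ?_
    filter_upwards [eventually_ge_atTop 0] with N hN
    refine le_trans (le_of_eq ?_) (hI N hN)
    refine intervalIntegral.integral_congr fun y _ => ?_
    rw [Real.norm_of_nonneg (by positivity)]
  have hI1 : IntegrableOn (fun y => ‖h1 y‖ ^ 2) (Ioi 0) := by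
    refine Integrable.mono' hsum (Continuous.aestronglyMeasurable (by fun_prop)) ?_
    filter_upwards with y
    rw [Real.norm_of_nonneg (by positivity)]
    exact le_add_of_nonneg_right (sq_nonneg _)
  have hI2 : IntegrableOn (fun y => 2 * inner ℝ (h1 y) (h2 y)) (Ioi 0) := by
    refine Integrable.mono' hsum (Continuous.aestronglyMeasurable (by fun_prop)) ?_
    filter_upwards with y
    rw [norm_mul, Real.norm_two]
    have := norm_inner_le_norm (𝕜 := ℝ) (h1 y) (h2 y)
    nlinarith [sq_nonneg (‖h1 y‖ - ‖h2 y‖)]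
  have hlim := tendsto_zero_of_hasDerivAt_of_integrableOn_Ioi
    (fun y _ => (hc.d1 y).norm_sq) hI2 hI1
  have hlim1 : Tendsto (fun y => ‖h1 y‖) atTop (nhds 0) := by
    have h := (Real.continuous_sqrt.tendsto 0).comp hlim
    rw [Real.sqrt_zero] at h
    refine h.congr fun y => ?_
    simp [Real.sqrt_sq (norm_nonneg _)]
  have hlim2 := (tendsto_zero_iff_abs_tendsto_zero _).1 hP.t1
  have hbig : Tendsto (fun y => (‖μ‖ + 1) * ‖h1 y‖ + Real.sqrt C * |(1 + y) * U1 y|) atTop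
      (nhds 0) := by
    simpa using (hlim1.const_mul (‖μ‖ + 1)).add (hlim2.const_mul (Real.sqrt C))
  refine squeeze_zero_norm' ?_ hbig
  filter_upwards [eventually_ge_atTop 0] with y hy
  have hm := sub_ne_zero_of_im hμ (U y)
  have e : φ1 y = (μ - U y) * h1 y - U1 y * hv0 U μ φ y := by
    rw [hh1, hv1, mul_div_cancel₀ _ hm]; ring
  have n0 : ‖hv0 U μ φ y‖ ≤ Real.sqrt C * (1 + y) := by
    have a1 := norm_sq_le_of_primitive hc.d0 c1 e00 hy
    have a2 : ∫ s in (0:ℝ)..y, ‖h1 s‖ ^ 2 ≤ C := by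
      refine le_trans ?_ (hI y hy)
      refine intervalIntegral.integral_mono_on hy (Continuous.intervalIntegrable (by fun_prop) _ _)
        (Continuous.intervalIntegrable (by fun_prop) _ _) ?_
      intro s _
      exact le_add_of_nonneg_right (sq_nonneg _)
    have a3 : ‖hv0 U μ φ y‖ ^ 2 ≤ (Real.sqrt C * (1 + y)) ^ 2 := by
      rw [mul_pow, Real.sq_sqrt hC0]
      calc _ ≤ y * C := a1.trans (mul_le_mul_of_nonneg_left a2 hy)
        _ ≤ C * (1 + y) ^ 2 := by nlinarith [mul_nonneg hy hC0, mul_nonneg (sq_nonneg y) hC0]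
    exact (sq_le_sq₀ (norm_nonneg _) (by positivity)).1 a3
  rw [e]
  refine (norm_sub_le _ _).trans ?_
  rw [norm_mul, norm_mul, Complex.norm_real, Real.norm_eq_abs]
  have nm : ‖μ - (U y : ℂ)‖ ≤ ‖μ‖ + 1 := by
    refine (norm_sub_le _ _).trans ?_
    rw [Complex.norm_real]
    have := hP.bU y hy
    rw [Real.norm_eq_abs]; linarith
  refine add_le_add (by gcongr) ?_
  rw [abs_mul, abs_of_nonneg (by linarith : (0:ℝ) ≤ 1 + y)]
  calc |U1 y| * ‖hv0 U μ φ y‖ ≤ |U1 y| * (Real.sqrt C * (1 + y)) := by gcongr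
    _ = _ := by ring

lemma hv1_q_ne (hP : Prof U U1 U2 U3 M M3 B B2 B3) (hη : 0 < η) (hk : 0 < k)
    (hμ : η ≤ μ.im) (hkK : Kthr M M3 η ≤ k) (hq : Chain q q1 q2 q3)
    (h0 : q 0 = 0) (h1 : q1 0 = 0) (h2 : q2 0 = 1)
    (hode : ∀ y, 0 ≤ y → (μ - U y) * q1 y + U1 y * q y - Complex.I / (k:ℂ) * q3 y = 0)
    {N : ℝ} (hN : 0 < N) : hv1 U U1 μ q q1 N ≠ 0 := by
  intro hz
  have hτ : 0 < μ.im := hη.trans_le hμ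
  have hc := hq.hv hP hτ
  have c2 := hc.cc2
  have he := energy_chain (f := fun _ => 0) hP hη hk hμ hkK hq continuous_const h0 h1 hode hN.le
  have hfl : flux U μ k (hv1 U U1 μ q q1) (hv2 U U1 U2 μ q q1 q2) N = 0 := by
    simp [flux, hz]
  rw [hfl] at he
  simp only [norm_zero, ne_eq, OfNat.ofNat_ne_zero, not_false_eq_true, zero_pow,
      intervalIntegral.integral_zero, zero_div, add_zero] at he
  have hI1 : 0 ≤ ∫ s in (0:ℝ)..N, ‖hv1 U U1 μ q q1 s‖ ^ 2 :=
    intervalIntegral.integral_nonneg hN.le fun s _ => by positivity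
  have hI2 : 0 < ∫ s in (0:ℝ)..N, ‖hv2 U U1 U2 μ q q1 q2 s‖ ^ 2 := by
    refine intervalIntegral.integral_pos hN (by fun_prop) (fun s _ => by positivity)
      ⟨0, ⟨le_rfl, hN.le⟩, ?_⟩
    have : hv2 U U1 U2 μ q q1 q2 0 ≠ 0 := by
      simp only [hv2, hv1, hv0, h0, h1, h2]
      simpa using sub_ne_zero_of_im hτ (U 0)
    positivity
  have hcpos : 0 < η / (2 * k * (‖μ‖ + 1) ^ 2) := by positivity
  have := mul_pos hcpos hI2
  linarith

lemma q_ne (hP : Prof U U1 U2 U3 M M3 B B2 B3) (hη : 0 < η) (hk : 0 < k)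
    (hμ : η ≤ μ.im) (hkK : Kthr M M3 η ≤ k) (hq : Chain q q1 q2 q3)
    (h0 : q 0 = 0) (h1 : q1 0 = 0) (h2 : q2 0 = 1)
    (hode : ∀ y, 0 ≤ y → (μ - U y) * q1 y + U1 y * q y - Complex.I / (k:ℂ) * q3 y = 0) :
    ∃ y, 0 ≤ y ∧ q y ≠ 0 := by
  by_contra! hcon
  refine hv1_q_ne hP hη hk hμ hkK hq h0 h1 h2 hode one_pos ?_
  have e1 : q1 1 = 0 := by
    refine (hq.d0 1).unique ?_
    refine (hasDerivAt_const (1:ℝ) (0:ℂ)).congr_of_eventuallyEq ?_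
    filter_upwards [lt_mem_nhds (one_pos : (0:ℝ) < 1)] with y hy using hcon y hy.le
  simp [hv1, hv0, e1, hcon 1 zero_le_one]

/-- truncated coefficient -/
noncomputable def aTr (U U1 : ℝ → ℝ) (μ : ℂ) (p p1 q q1 : ℝ → ℂ) (N : ℝ) : ℂ :=
  -hv1 U U1 μ p p1 N / hv1 U U1 μ q q1 N

lemma trunc_energy (hP : Prof U U1 U2 U3 M M3 B B2 B3) (hη : 0 < η) (hk : 0 < k)
    (hμ : η ≤ μ.im) (hkK : Kthr M M3 η ≤ k) (hp : Chain p p1 p2 p3) (hq : Chain q q1 q2 q3)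
    (hp0 : p 0 = 0) (hp1 : p1 0 = 0)
    (hq0 : q 0 = 0) (hq1 : q1 0 = 0) (hq2 : q2 0 = 1) (hf : Continuous f)
    (hodep : ∀ y, 0 ≤ y → (μ - U y) * p1 y + U1 y * p y - Complex.I / (k:ℂ) * p3 y = f y)
    (hodeq : ∀ y, 0 ≤ y → (μ - U y) * q1 y + U1 y * q y - Complex.I / (k:ℂ) * q3 y = 0)
    {R : ℝ} (hR : ∀ N, 0 ≤ N → ∫ y in (0:ℝ)..N, ‖f y‖ ^ 2 ≤ R)
    {N : ℝ} (hN : 0 < N) (a : ℂ) (ha : a = aTr U U1 μ p p1 q q1 N) :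
    1 / 2 * (∫ y in (0:ℝ)..N, ‖hv1 U U1 μ p p1 y + a * hv1 U U1 μ q q1 y‖ ^ 2)
      + η / (2 * k * (‖μ‖ + 1) ^ 2) *
        (∫ y in (0:ℝ)..N, ‖hv2 U U1 U2 μ p p1 p2 y + a * hv2 U U1 U2 μ q q1 q2 y‖ ^ 2)
      ≤ R / η ^ 4 := by
  have hne := hv1_q_ne hP hη hk hμ hkK hq hq0 hq1 hq2 hodeq hN
  have he := energy_chain hP hη hk hμ hkK (hp.comb hq a) hf (by simp [hp0, hq0])
    (by simp [hp1, hq1]) (fun y hy => by linear_combination hodep y hy + a * hodeq y hy) hN.le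
  simp only [hv1_comb, hv2_comb] at he
  have hz : hv1 U U1 μ p p1 N + a * hv1 U U1 μ q q1 N = 0 := by
    rw [ha, aTr, div_mul_cancel₀ _ hne]; ring
  have hfl : flux U μ k (hv1 U U1 μ (fun y => p y + a * q y) fun y => p1 y + a * q1 y)
      (hv2 U U1 U2 μ (fun y => p y + a * q y) (fun y => p1 y + a * q1 y)
        fun y => p2 y + a * q2 y) N = 0 := by
    simp only [flux]
    rw [hv1_comb, hz]; simp
  rw [hfl, zero_add] at he
  refine he.trans ?_
  gcongr
  exact hR N hN.le

lemma trunc_bound (hP : Prof U U1 U2 U3 M M3 B B2 B3) (hη : 0 < η) (hk : 0 < k)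
    (hμ : η ≤ μ.im) (hkK : Kthr M M3 η ≤ k) (hp : Chain p p1 p2 p3) (hq : Chain q q1 q2 q3)
    (hp0 : p 0 = 0) (hp1 : p1 0 = 0)
    (hq0 : q 0 = 0) (hq1 : q1 0 = 0) (hq2 : q2 0 = 1) (hf : Continuous f)
    (hodep : ∀ y, 0 ≤ y → (μ - U y) * p1 y + U1 y * p y - Complex.I / (k:ℂ) * p3 y = f y)
    (hodeq : ∀ y, 0 ≤ y → (μ - U y) * q1 y + U1 y * q y - Complex.I / (k:ℂ) * q3 y = 0)
    {R : ℝ} (hR : ∀ N, 0 ≤ N → ∫ y in (0:ℝ)..N, ‖f y‖ ^ 2 ≤ R)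
    {N : ℝ} (hN : 0 < N) {y : ℝ} (hy : 0 ≤ y) (hyN : y ≤ N) :
    ‖p y + aTr U U1 μ p p1 q q1 N * q y‖ ≤ (‖μ‖ + 1) * Real.sqrt (y * (2 * (R / η ^ 4))) := by
  have hτ : 0 < μ.im := hη.trans_le hμ
  set a := aTr U U1 μ p p1 q q1 N with ha
  have he := trunc_energy hP hη hk hμ hkK hp hq hp0 hp1 hq0 hq1 hq2 hf hodep hodeq hR hN a ha
  have hI2 : 0 ≤ ∫ y in (0:ℝ)..N, ‖hv2 U U1 U2 μ p p1 p2 y + a * hv2 U U1 U2 μ q q1 q2 y‖ ^ 2 :=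
    intervalIntegral.integral_nonneg hN.le fun s _ => by positivity
  have hcpos : 0 ≤ η / (2 * k * (‖μ‖ + 1) ^ 2) := by positivity
  have hI1 : ∫ y in (0:ℝ)..N, ‖hv1 U U1 μ p p1 y + a * hv1 U U1 μ q q1 y‖ ^ 2 ≤ 2 * (R / η ^ 4) := by
    have := mul_nonneg hcpos hI2
    linarith
  have hc := (hp.comb hq a).hv hP hτ
  have c1 := hc.cc1
  have a1 := norm_sq_le_of_primitive hc.d0 c1 (by simp [hv0, hp0, hq0]) hy
  have a2 : ∫ s in (0:ℝ)..y, ‖hv1 U U1 μ (fun y => p y + a * q y) (fun y => p1 y + a * q1 y) s‖ ^ 2 ≤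
      2 * (R / η ^ 4) := by
    refine le_trans ?_ hI1
    have c1' := c1.congr (fun s => hv1_comb (U := U) (U1 := U1) (μ := μ) (p := p) (p1 := p1)
      (q := q) (q1 := q1) a s)
    simp only [hv1_comb]
    exact intervalIntegral.integral_mono_interval le_rfl hy hyN
        (Eventually.of_forall fun y => sq_nonneg _) ((c1'.norm.pow 2).intervalIntegrable _ _)
  have a3 : ‖hv0 U μ (fun y => p y + a * q y) y‖ ≤ Real.sqrt (y * (2 * (R / η ^ 4))) :=
    Real.le_sqrt_of_sq_le (a1.trans (mul_le_mul_of_nonneg_left a2 hy))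
  have hm := sub_ne_zero_of_im hτ (U y)
  have e : p y + a * q y = (μ - U y) * hv0 U μ (fun y => p y + a * q y) y := by
    rw [hv0, mul_div_cancel₀ _ hm]
  have nm : ‖μ - (U y : ℂ)‖ ≤ ‖μ‖ + 1 := by
    refine (norm_sub_le _ _).trans ?_
    rw [Complex.norm_real]
    have := hP.bU y hy
    rw [Real.norm_eq_abs]; linarith
  rw [e, norm_mul]
  gcongr

lemma limit_exists (hP : Prof U U1 U2 U3 M M3 B B2 B3) (hη : 0 < η) (hk : 0 < k)
    (hμ : η ≤ μ.im) (hkK : Kthr M M3 η ≤ k) (hp : Chain p p1 p2 p3) (hq : Chain q q1 q2 q3)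
    (hp0 : p 0 = 0) (hp1 : p1 0 = 0)
    (hq0 : q 0 = 0) (hq1 : q1 0 = 0) (hq2 : q2 0 = 1) (hf : Continuous f)
    (hodep : ∀ y, 0 ≤ y → (μ - U y) * p1 y + U1 y * p y - Complex.I / (k:ℂ) * p3 y = f y)
    (hodeq : ∀ y, 0 ≤ y → (μ - U y) * q1 y + U1 y * q y - Complex.I / (k:ℂ) * q3 y = 0)
    {R : ℝ} (hR : ∀ N, 0 ≤ N → ∫ y in (0:ℝ)..N, ‖f y‖ ^ 2 ≤ R) :
    ∃ a, Tendsto (fun n : ℕ => aTr U U1 μ p p1 q q1 ((n:ℝ) + 1)) atTop (nhds a) ∧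
      Tendsto (fun y => p1 y + a * q1 y) atTop (nhds 0) := by
  have hτ : 0 < μ.im := hη.trans_le hμ
  have hcp := hp.hv hP hτ
  have hcq := hq.hv hP hτ
  have cp1 := hcp.cc1
  have cp2 := hcp.cc2
  have cq1 := hcq.cc1
  have cq2 := hcq.cc2
  set u1 := hv1 U U1 μ p p1 with hu1
  set u2 := hv2 U U1 U2 μ p p1 p2 with hu2
  set v1 := hv1 U U1 μ q q1 with hv1d
  set v2 := hv2 U U1 U2 μ q q1 q2 with hv2d
  set an : ℕ → ℂ := fun n => aTr U U1 μ p p1 q q1 ((n:ℝ) + 1) with han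
  set J : ℂ → ℝ → ℝ := fun a N => ∫ y in (0:ℝ)..N, (‖u1 y + a * v1 y‖ ^ 2 + ‖u2 y + a * v2 y‖ ^ 2)
    with hJ
  set c := η / (2 * k * (‖μ‖ + 1) ^ 2) with hcdef
  have hcpos : 0 < c := by positivity
  set c' := min (1/2) c with hc'
  have hc'pos : 0 < c' := lt_min (by norm_num) hcpos
  set C := R / η ^ 4 / c' with hC
  have hJe : ∀ a N, J a N = (∫ y in (0:ℝ)..N, ‖u1 y + a * v1 y‖ ^ 2) +
      ∫ y in (0:ℝ)..N, ‖u2 y + a * v2 y‖ ^ 2 := fun a N =>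
    intervalIntegral.integral_add (Continuous.intervalIntegrable (by fun_prop) _ _)
      (Continuous.intervalIntegrable (by fun_prop) _ _)
  have hJan : ∀ n : ℕ, J (an n) (n + 1) ≤ C := by
    intro n
    have hN : (0:ℝ) < n + 1 := by positivity
    have he := trunc_energy hP hη hk hμ hkK hp hq hp0 hp1 hq0 hq1 hq2 hf hodep hodeq hR hN
      (an n) rfl
    have hI1 : 0 ≤ ∫ y in (0:ℝ)..((n:ℝ)+1), ‖u1 y + an n * v1 y‖ ^ 2 :=
      intervalIntegral.integral_nonneg hN.le fun s _ => by positivity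
    have hI2 : 0 ≤ ∫ y in (0:ℝ)..((n:ℝ)+1), ‖u2 y + an n * v2 y‖ ^ 2 :=
      intervalIntegral.integral_nonneg hN.le fun s _ => by positivity
    have a1 := mul_le_mul_of_nonneg_right (min_le_left (1/2) c) hI1
    have a2 := mul_le_mul_of_nonneg_right (min_le_right (1/2) c) hI2
    rw [hC, le_div_iff₀ hc'pos, hJe, mul_comm, mul_add]
    linarith
  have hJmono : ∀ a N N', 0 ≤ N → N ≤ N' → J a N ≤ J a N' := by
    intro a N N' h0 h
    refine intervalIntegral.integral_mono_interval le_rfl h0 h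
        (Eventually.of_forall fun y => ?_) (Continuous.intervalIntegrable (by fun_prop) _ _)
    simp only [Pi.zero_apply]; positivity
  have hJev : ∀ N, 0 ≤ N → ∀ᶠ n in atTop, J (an n) N ≤ C := by
    intro N hN
    filter_upwards [eventually_ge_atTop ⌈N⌉₊] with n hn
    refine (hJmono _ _ _ hN ?_).trans (hJan n)
    have := Nat.ceil_le.1 hn
    linarith
  have hJcl : ∀ N, IsClosed {a | J a N ≤ C} := by
    intro N
    refine isClosed_le ?_ continuous_const
    refine intervalIntegral.continuous_parametric_intervalIntegral_of_continuous' ?_ _ _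
    simp only [Function.uncurry_def]
    fun_prop
  -- boundedness
  have hv1ne : v1 1 ≠ 0 := hv1_q_ne hP hη hk hμ hkK hq hq0 hq1 hq2 hodeq one_pos
  set V := ∫ y in (0:ℝ)..1, ‖v1 y‖ ^ 2 with hV
  set W := ∫ y in (0:ℝ)..1, ‖u1 y‖ ^ 2 with hW
  have hVpos : 0 < V := intervalIntegral.integral_pos one_pos (by fun_prop)
    (fun s _ => by positivity) ⟨1, ⟨zero_le_one, le_rfl⟩, by positivity⟩
  have hbound : ∀ a, J a 1 ≤ C → a ∈ Metric.closedBall (0:ℂ) (Real.sqrt ((2 * C + 2 * W) / V)) := by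
    intro a ha
    rw [mem_closedBall_zero_iff]
    refine Real.le_sqrt_of_sq_le ?_
    rw [le_div_iff₀ hVpos]
    have i1 : ‖a‖ ^ 2 * V ≤ 2 * (∫ y in (0:ℝ)..1, ‖u1 y + a * v1 y‖ ^ 2) + 2 * W := by
      rw [hV, hW, ← intervalIntegral.integral_const_mul, ← intervalIntegral.integral_const_mul,
        ← intervalIntegral.integral_const_mul, ← intervalIntegral.integral_add
        (Continuous.intervalIntegrable (by fun_prop) _ _)
        (Continuous.intervalIntegrable (by fun_prop) _ _)]
      refine intervalIntegral.integral_mono_on zero_le_one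
        (Continuous.intervalIntegrable (by fun_prop) _ _)
        (Continuous.intervalIntegrable (by fun_prop) _ _) ?_
      intro y _
      have t : ‖a * v1 y‖ ≤ ‖u1 y + a * v1 y‖ + ‖u1 y‖ := by
        have := norm_sub_le (u1 y + a * v1 y) (u1 y)
        simpa using this
      rw [norm_mul] at t
      calc ‖a‖ ^ 2 * ‖v1 y‖ ^ 2 = (‖a‖ * ‖v1 y‖) ^ 2 := by ring
        _ ≤ (‖u1 y + a * v1 y‖ + ‖u1 y‖) ^ 2 := by gcongr
        _ ≤ _ := by nlinarith [sq_nonneg (‖u1 y + a * v1 y‖ - ‖u1 y‖)]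
    have i2 : 0 ≤ ∫ y in (0:ℝ)..1, ‖u2 y + a * v2 y‖ ^ 2 :=
      intervalIntegral.integral_nonneg zero_le_one fun s _ => by positivity
    have := hJe a 1
    linarith
  have hK : IsCompact (Metric.closedBall (0:ℂ) (Real.sqrt ((2 * C + 2 * W) / V))) :=
    isCompact_closedBall _ _
  have hmem : ∀ᶠ n in atTop, an n ∈ Metric.closedBall (0:ℂ) (Real.sqrt ((2 * C + 2 * W) / V)) :=
    (hJev 1 zero_le_one).mono fun n hn => hbound _ hn
  have hcl : ∀ a, MapClusterPt a atTop an → ∀ N, 0 ≤ N → J a N ≤ C := fun a ha N hN =>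
    (hJcl N).mem_of_mapClusterPt ha (hJev N hN)
  have htend : ∀ a, (∀ N, 0 ≤ N → J a N ≤ C) → Tendsto (fun y => p1 y + a * q1 y) atTop (nhds 0) := by
    intro a ha
    refine tendsto_of_bdd hP hτ (hp.comb hq a) (by simp [hp0, hq0]) (C := C) ?_
    intro N hN
    simp only [hv1_comb, hv2_comb]
    exact ha N hN
  have huniq : ∀ a b, Tendsto (fun y => p1 y + a * q1 y) atTop (nhds 0) →
      Tendsto (fun y => p1 y + b * q1 y) atTop (nhds 0) → a = b := by
    intro a b ha hb
    obtain ⟨y, hy, hyq⟩ := q_ne hP hη hk hμ hkK hq hq0 hq1 hq2 hodeq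
    have hz : Chain (fun _ => (0:ℂ)) (fun _ => 0) (fun _ => 0) (fun _ => 0) :=
      ⟨fun y => hasDerivAt_const _ _, fun y => hasDerivAt_const _ _, fun y => hasDerivAt_const _ _,
        continuous_const⟩
    have hd := hz.comb hq (a - b)
    have := uniq_zero hP hη hk hμ hkK hd (by simp [hq0]) (by simp [hq1])
      (by
        have := ha.sub hb
        rw [sub_zero] at this
        refine this.congr fun y => ?_
        ring) (fun y hy => by linear_combination (a - b) * hodeq y hy) hy
    simp only [zero_add, mul_eq_zero, hyq, or_false] at this
    exact sub_eq_zero.1 this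
  obtain ⟨a, _, ha⟩ := hK.exists_mapClusterPt (f := atTop) (u := an)
    (by rw [le_principal_iff]; exact hmem)
  refine ⟨a, hK.tendsto_nhds_of_unique_mapClusterPt hmem fun b _ hb => ?_, htend a (hcl a ha)⟩
  exact huniq b a (htend b (hcl b hb)) (htend a (hcl a ha))
end


section
variable {U U1 U2 U3 : ℝ → ℝ} {M M3 B B2 B3 : ℝ} {η k : ℝ}

/-- the lift `1 - e^{-y}` of the boundary data -/
noncomputable def lft (y : ℝ) : ℂ := 1 - (Real.exp (-y) : ℂ)

lemma hasDerivAt_expneg (y : ℝ) :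
    HasDerivAt (fun y : ℝ => (Real.exp (-y) : ℂ)) (-(Real.exp (-y) : ℂ)) y := by
  have := ((hasDerivAt_id y).neg.exp).ofReal_comp
  refine this.congr_deriv ?_
  simp

/-- forcing after lifting -/
noncomputable def frc (U U1 : ℝ → ℝ) (k : ℝ) (μ : ℂ) (y : ℝ) : ℂ :=
  ((1 - U y : ℝ) : ℂ) + (((y - 1 + Real.exp (-y)) * U1 y : ℝ) : ℂ)
    - (μ - U y - Complex.I / (k:ℂ)) * (Real.exp (-y) : ℂ)

lemma frc_bound (hP : Prof U U1 U2 U3 M M3 B B2 B3) (hk : 1 ≤ k) (μ : ℂ) {N : ℝ} (hN : 0 ≤ N) :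
    ∫ y in (0:ℝ)..N, ‖frc U U1 k μ y‖ ^ 2 ≤ 3 * (B2 + B3 + (‖μ‖ + 2) ^ 2) := by
  have cU := hP.cU
  have cU1 := hP.cU1
  have hpt : ∀ y ∈ Icc 0 N, ‖frc U U1 k μ y‖ ^ 2 ≤
      3 * (1 - U y) ^ 2 + 3 * ((1 + y) * U1 y) ^ 2 + 3 * (‖μ‖ + 2) ^ 2 * Real.exp (-y) := by
    intro y hy
    have hy0 := hy.1
    have hE : Real.exp (-y) ≤ 1 := Real.exp_le_one_iff.2 (by linarith)
    have hE0 := Real.exp_pos (-y)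
    set E := Real.exp (-y) with hEdef
    have n1 : ‖((1 - U y : ℝ) : ℂ)‖ = |1 - U y| := by rw [Complex.norm_real, Real.norm_eq_abs]
    have n2 : ‖(((y - 1 + E) * U1 y : ℝ) : ℂ)‖ ≤ |(1 + y) * U1 y| := by
      rw [Complex.norm_real, Real.norm_eq_abs, abs_mul, abs_mul]
      refine mul_le_mul_of_nonneg_right ?_ (abs_nonneg _)
      rw [abs_of_nonneg (by linarith : 0 ≤ 1 + y), abs_le]
      constructor <;> linarith
    have n3 : ‖(μ - U y - Complex.I / (k:ℂ)) * (E : ℂ)‖ ≤ (‖μ‖ + 2) * E := by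
      rw [norm_mul, Complex.norm_real, Real.norm_of_nonneg hE0.le]
      gcongr
      refine (norm_sub_le _ _).trans ?_
      have a1 : ‖μ - (U y : ℂ)‖ ≤ ‖μ‖ + 1 := by
        refine (norm_sub_le _ _).trans ?_
        rw [Complex.norm_real]
        have := hP.bU y hy0
        rw [Real.norm_eq_abs]; linarith
      have a2 : ‖Complex.I / (k:ℂ)‖ ≤ 1 := by
        rw [norm_div, Complex.norm_I, Complex.norm_real, Real.norm_of_nonneg (by linarith)]
        exact (div_le_one (by linarith)).2 hk
      linarith
    have n : ‖frc U U1 k μ y‖ ≤ |1 - U y| + |(1 + y) * U1 y| + (‖μ‖ + 2) * E := by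
      refine (norm_sub_le _ _).trans (add_le_add ((norm_add_le _ _).trans (add_le_add n1.le n2)) n3)
    have hE2 : ((‖μ‖ + 2) * E) ^ 2 ≤ (‖μ‖ + 2) ^ 2 * E := by
      rw [mul_pow]
      gcongr
      nlinarith
    rw [← sq_abs (1 - U y), ← sq_abs ((1 + y) * U1 y)]
    set a := |1 - U y|
    set b := |(1 + y) * U1 y|
    set d := (‖μ‖ + 2) * E
    calc ‖frc U U1 k μ y‖ ^ 2 ≤ (a + b + d) ^ 2 := by gcongr
      _ ≤ 3 * a ^ 2 + 3 * b ^ 2 + 3 * d ^ 2 := by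
        nlinarith [sq_nonneg (a - b), sq_nonneg (b - d), sq_nonneg (a - d)]
      _ ≤ _ := by linarith
  have hc : Continuous (frc U U1 k μ) := by unfold frc; fun_prop
  have h1 := intervalIntegral.integral_mono_on (μ := volume) hN
    (Continuous.intervalIntegrable (by fun_prop) _ _)
    (Continuous.intervalIntegrable (by fun_prop) _ _) hpt
  rw [intervalIntegral.integral_add (Continuous.intervalIntegrable (by fun_prop) _ _)
      (Continuous.intervalIntegrable (by fun_prop) _ _),
    intervalIntegral.integral_add (Continuous.intervalIntegrable (by fun_prop) _ _)
      (Continuous.intervalIntegrable (by fun_prop) _ _),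
    intervalIntegral.integral_const_mul, intervalIntegral.integral_const_mul,
    intervalIntegral.integral_const_mul] at h1
  have hexp : ∫ y in (0:ℝ)..N, Real.exp (-y) ≤ 1 := by
    rw [intervalIntegral.integral_comp_neg (fun y => Real.exp y), integral_exp]
    have := Real.exp_pos (-N)
    simp only [neg_zero, Real.exp_zero]; linarith
  have e := mul_le_mul_of_nonneg_left hexp (by positivity : 0 ≤ 3 * (‖μ‖ + 2) ^ 2)
  have := hP.i0 N hN
  have := hP.i1 N hN
  linarith

lemma hv1_differentiableAt {P P1 : ℂ → ℝ → ℂ} {y : ℝ} {μ : ℂ} (hμ : 0 < μ.im)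
    (h : Differentiable ℂ fun μ => P μ y) (h1 : Differentiable ℂ fun μ => P1 μ y) :
    DifferentiableAt ℂ (fun μ => hv1 U U1 μ (P μ) (P1 μ) y) μ := by
  have hm := sub_ne_zero_of_im hμ (U y)
  simp only [hv1, hv0]
  have hd : DifferentiableAt ℂ (fun μ : ℂ => μ - (U y : ℂ)) μ := by fun_prop
  exact ((h1 μ).add (((h μ).div hd hm).const_mul _)).div hd hm

lemma family (hP : Prof U U1 U2 U3 M M3 B B2 B3) (hB2 : 0 ≤ B2) (hB3 : 0 ≤ B3)
    (hη : 0 < η) (hk : 1 ≤ k) (hkK : Kthr M M3 η ≤ k) :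
    ∃ s s1 s2 : ℂ → ℝ → ℂ,
      (∀ μ y, HasDerivAt (s μ) (s1 μ y) y) ∧ (∀ μ y, HasDerivAt (s1 μ) (s2 μ y) y) ∧
      (∀ μ y, HasDerivAt (s2 μ) (-(Complex.I * k) * ((μ - U y) * s1 μ y + U1 y * s μ y
        - ((1 - U y + y * U1 y : ℝ) : ℂ))) y) ∧
      (∀ μ, s μ 0 = 0) ∧ (∀ μ, s1 μ 0 = 1) ∧
      (∀ μ : ℂ, η ≤ μ.im → Tendsto (s1 μ) atTop (nhds 0)) ∧
      ∀ y, DifferentiableOn ℂ (fun μ => s μ y) {μ : ℂ | η < μ.im} := by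
  have cU := hP.cU
  have cU1 := hP.cU1
  have hk0 : 0 < k := by linarith
  have hkC : (k:ℂ) ≠ 0 := by exact_mod_cast hk0.ne'
  obtain ⟨P, P1, P2, hPi, hPd0, hPd1, hPd2, hPμ, hPμ1, -⟩ := ivp3 U U1 cU cU1 (-(Complex.I * k))
    (fun y => ((1 - U y + y * U1 y : ℝ) : ℂ)) (by fun_prop) 0 1 (-1)
  obtain ⟨Q, Q1, Q2, hQi, hQd0, hQd1, hQd2, hQμ, hQμ1, -⟩ := ivp3 U U1 cU cU1 (-(Complex.I * k))
    (fun y => 0) continuous_const 0 0 1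
  set P3 : ℂ → ℝ → ℂ := fun μ y => -(Complex.I * k) * ((μ - U y) * P1 μ y + U1 y * P μ y
        - ((1 - U y + y * U1 y : ℝ) : ℂ)) with hP3
  set Q3 : ℂ → ℝ → ℂ := fun μ y => -(Complex.I * k) * ((μ - U y) * Q1 μ y + U1 y * Q μ y - 0)
    with hQ3
  have hPc0 : ∀ μ, Continuous (P μ) := fun μ =>
    continuous_iff_continuousAt.2 fun y => (hPd0 μ y).continuousAt
  have hPc1 : ∀ μ, Continuous (P1 μ) := fun μ =>
    continuous_iff_continuousAt.2 fun y => (hPd1 μ y).continuousAt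
  have hQc0 : ∀ μ, Continuous (Q μ) := fun μ =>
    continuous_iff_continuousAt.2 fun y => (hQd0 μ y).continuousAt
  have hQc1 : ∀ μ, Continuous (Q1 μ) := fun μ =>
    continuous_iff_continuousAt.2 fun y => (hQd1 μ y).continuousAt
  have hQch : ∀ μ, Chain (Q μ) (Q1 μ) (Q2 μ) (Q3 μ) := fun μ =>
    ⟨hQd0 μ, hQd1 μ, hQd2 μ, by have := hQc0 μ; have := hQc1 μ; fun_prop⟩
  have hPch : ∀ μ, Chain (P μ) (P1 μ) (P2 μ) (P3 μ) := fun μ =>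
    ⟨hPd0 μ, hPd1 μ, hPd2 μ, by have := hPc0 μ; have := hPc1 μ; fun_prop⟩
  have hL : Chain lft (fun y => (Real.exp (-y) : ℂ)) (fun y => -(Real.exp (-y) : ℂ))
      (fun y => (Real.exp (-y) : ℂ)) := by
    refine ⟨fun y => ?_, hasDerivAt_expneg, fun y => ?_, by fun_prop⟩
    · exact ((hasDerivAt_expneg y).const_sub 1).congr_deriv (by simp)
    · exact ((hasDerivAt_expneg y).fun_neg).congr_deriv (by simp)
  have hpch := fun μ => (hPch μ).comb hL (-1)
  set p : ℂ → ℝ → ℂ := fun μ y => P μ y + (-1) * lft y with hp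
  set p1 : ℂ → ℝ → ℂ := fun μ y => P1 μ y + (-1) * (Real.exp (-y) : ℂ) with hp1
  set p3 : ℂ → ℝ → ℂ := fun μ y => P3 μ y + (-1) * (Real.exp (-y) : ℂ) with hp3
  have hIk : Complex.I / (k:ℂ) * (-(Complex.I * k)) = 1 := by
    field_simp; simp
  have hodep : ∀ μ : ℂ, ∀ y, 0 ≤ y → (μ - U y) * p1 μ y + U1 y * p μ y
      - Complex.I / (k:ℂ) * p3 μ y = frc U U1 k μ y := by
    intro μ y _
    simp only [hp, hp1, hp3, hP3, frc, lft]
    push_cast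
    linear_combination (-((μ - U y) * P1 μ y + U1 y * P μ y
        - (1 - U y + y * U1 y))) * hIk
  have hodeq : ∀ μ : ℂ, ∀ y, 0 ≤ y → (μ - U y) * Q1 μ y + U1 y * Q μ y
      - Complex.I / (k:ℂ) * Q3 μ y = 0 := by
    intro μ y _
    simp only [hQ3]
    linear_combination (-((μ - U y) * Q1 μ y + U1 y * Q μ y)) * hIk
  have hp0 : ∀ μ, p μ 0 = 0 := fun μ => by simp [hp, lft, (hPi μ).1]
  have hp10 : ∀ μ, p1 μ 0 = 0 := fun μ => by simp [hp1, (hPi μ).2.1]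
  have hfc : ∀ μ, Continuous (frc U U1 k μ) := fun μ => by unfold frc; fun_prop
  have hR : ∀ μ : ℂ, ∀ N, 0 ≤ N → ∫ y in (0:ℝ)..N, ‖frc U U1 k μ y‖ ^ 2 ≤
    3 * (B2 + B3 + (‖μ‖ + 2) ^ 2) := fun μ N hN => frc_bound hP hk μ hN
  have hex : ∀ μ : ℂ, ∃ a, η ≤ μ.im →
      (Tendsto (fun n : ℕ => aTr U U1 μ (p μ) (p1 μ) (Q μ) (Q1 μ) ((n:ℝ) + 1)) atTop (nhds a) ∧
      Tendsto (fun y => p1 μ y + a * Q1 μ y) atTop (nhds 0)) := by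
    intro μ
    by_cases hμ : η ≤ μ.im
    · obtain ⟨a, ha⟩ := limit_exists hP hη hk0 hμ hkK (hpch μ) (hQch μ) (hp0 μ) (hp10 μ)
        (hQi μ).1 (hQi μ).2.1 (hQi μ).2.2 (hfc μ) (hodep μ) (hodeq μ) (hR μ)
      exact ⟨a, fun _ => ha⟩
    · exact ⟨0, fun h => absurd h hμ⟩
  choose a ha using hex
  have hsd : ∀ y, 0 ≤ y → ∀ μ : ℂ, η < μ.im → DifferentiableAt ℂ (fun μ => P μ y + a μ * Q μ y) μ := by
    intro y hy μ₀ hμ₀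
    set r := μ₀.im - η with hr
    have hr0 : 0 < r := by linarith
    have hball : ∀ z ∈ Metric.closedBall μ₀ r, η ≤ z.im ∧ ‖z‖ ≤ ‖μ₀‖ + r := by
      intro z hz
      rw [Metric.mem_closedBall, dist_eq_norm] at hz
      have h1 := (Complex.abs_im_le_norm (z - μ₀)).trans hz
      rw [Complex.sub_im, abs_le] at h1
      refine ⟨by linarith [h1.1], ?_⟩
      have := norm_add_le (z - μ₀) μ₀
      rw [sub_add_cancel] at this
      linarith
    set m := ⌈y⌉₊ with hm
    have hym : y ≤ m := Nat.le_ceil y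
    set Z := ‖μ₀‖ + r with hZ
    refine differentiableAt_of_bdd_limit (f := fun n μ => P μ y +
      aTr U U1 μ (p μ) (p1 μ) (Q μ) (Q1 μ) (((n + m : ℕ) : ℝ) + 1) * Q μ y) (R := r)
      (C := (Z + 1) * Real.sqrt (y * (2 * ((3 * (B2 + B3 + (Z + 2) ^ 2)) / η ^ 4))) + ‖lft y‖)
      hr0 ?_ ?_ ?_
    · intro n z hz
      have hz' := (hball z hz).1
      have hzi : 0 < z.im := hη.trans_le hz'
      have hNp : (0:ℝ) < (((n + m : ℕ) : ℝ) + 1) := by positivity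
      have hne := hv1_q_ne hP hη hk0 hz' hkK (hQch z) (hQi z).1 (hQi z).2.1 (hQi z).2.2
        (hodeq z) hNp
      refine DifferentiableAt.differentiableWithinAt ?_
      refine (hPμ y z).add (DifferentiableAt.mul ?_ (hQμ y z))
      unfold aTr
      refine DifferentiableAt.div (DifferentiableAt.neg ?_) ?_ hne
      · refine hv1_differentiableAt hzi ?_ ?_
        · exact (hPμ _).add_const _
        · exact (hPμ1 _).add_const _
      · exact hv1_differentiableAt hzi (hQμ _) (hQμ1 _)
    · intro n z hz
      have hz' := (hball z hz).1
      have hNp : (0:ℝ) < (((n + m : ℕ) : ℝ) + 1) := by positivity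
      have hyN : y ≤ (((n + m : ℕ) : ℝ) + 1) := by
        push_cast
        have : (0:ℝ) ≤ n := by positivity
        linarith
      have hb := trunc_bound hP hη hk0 hz' hkK (hpch z) (hQch z) (hp0 z) (hp10 z)
        (hQi z).1 (hQi z).2.1 (hQi z).2.2 (hfc z) (hodep z) (hodeq z) (hR z) hNp hy hyN
      have hzn := (hball z hz).2
      have e : P z y + aTr U U1 z (p z) (p1 z) (Q z) (Q1 z) (((n + m : ℕ) : ℝ) + 1) * Q z y =
          (p z y + aTr U U1 z (p z) (p1 z) (Q z) (Q1 z) (((n + m : ℕ) : ℝ) + 1) * Q z y) + lft y := by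
        simp only [hp]; ring
      rw [e]
      refine (norm_add_le _ _).trans ?_
      refine add_le_add (hb.trans ?_) le_rfl
      gcongr
    · intro z hz
      have hz' := (hball z hz).1
      have h1 := (tendsto_add_atTop_iff_nat m).2 (ha z hz').1
      exact (h1.mul_const _).const_add _
  have had : ∀ μ : ℂ, η < μ.im → DifferentiableAt ℂ a μ := by
    intro μ hμ
    obtain ⟨y, hy, hQy⟩ := q_ne hP hη hk0 hμ.le hkK (hQch μ) (hQi μ).1 (hQi μ).2.1 (hQi μ).2.2 (hodeq μ)
    have h1 := ((hsd y hy μ hμ).sub (hPμ y μ)).div (hQμ y μ) hQy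
    refine h1.congr_of_eventuallyEq ?_
    have : ∀ᶠ z in nhds μ, Q z y ≠ 0 := (hQμ y μ).continuousAt.eventually_ne hQy
    filter_upwards [this] with z hz
    simp only [Pi.div_apply, Pi.sub_apply]
    field_simp
    ring
  refine ⟨fun μ y => P μ y + a μ * Q μ y, fun μ y => P1 μ y + a μ * Q1 μ y,
    fun μ y => P2 μ y + a μ * Q2 μ y, ?_, ?_, ?_, ?_, ?_, ?_, ?_⟩
  · exact fun μ y => ((hPch μ).comb (hQch μ) (a μ)).d0 y
  · exact fun μ y => ((hPch μ).comb (hQch μ) (a μ)).d1 y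
  · intro μ y
    refine (((hPch μ).comb (hQch μ) (a μ)).d2 y).congr_deriv ?_
    simp only [hP3, hQ3]
    ring
  · intro μ; simp [(hPi μ).1, (hQi μ).1]
  · intro μ; simp [(hPi μ).2.1, (hQi μ).2.1]
  · intro μ hμ
    have h1 := (ha μ hμ).2
    have h2 : Tendsto (fun y : ℝ => (Real.exp (-y) : ℂ)) atTop (nhds 0) := by
      have := (Complex.continuous_ofReal.tendsto 0).comp
        (Real.tendsto_exp_neg_atTop_nhds_zero)
      simpa [Function.comp_def] using this
    have h3 := h1.add h2
    rw [add_zero] at h3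
    refine h3.congr fun y => ?_
    simp only [hp1]
    ring
  · intro y μ hμ
    exact ((hPμ y μ).add ((had μ hμ).mul (hQμ y μ))).differentiableWithinAt

lemma contDiff_of_chain {V V1 : ℝ → ℝ} {g φ φ1 φ2 : ℝ → ℂ} {c μ : ℂ}
    (hV : ContDiff ℝ (⊤ : ℕ∞) V) (hV1 : ContDiff ℝ (⊤ : ℕ∞) V1) (hg : ContDiff ℝ (⊤ : ℕ∞) g)
    (h0 : ∀ y, HasDerivAt φ (φ1 y) y) (h1 : ∀ y, HasDerivAt φ1 (φ2 y) y)
    (h2 : ∀ y, HasDerivAt φ2 (c * ((μ - V y) * φ1 y + V1 y * φ y - g y)) y) :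
    ContDiff ℝ (⊤ : ℕ∞) φ := by
  have key : ∀ n : ℕ, ContDiff ℝ n φ ∧ ContDiff ℝ n φ1 ∧ ContDiff ℝ n φ2 := by
    intro n
    induction n with
    | zero =>
      simp only [Nat.cast_zero, contDiff_zero]
      exact ⟨continuous_iff_continuousAt.2 fun y => (h0 y).continuousAt,
        continuous_iff_continuousAt.2 fun y => (h1 y).continuousAt,
        continuous_iff_continuousAt.2 fun y => (h2 y).continuousAt⟩
    | succ n ih =>
      obtain ⟨i0, i1, i2⟩ := ih
      have e0 : deriv φ = φ1 := funext fun y => (h0 y).deriv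
      have e1 : deriv φ1 = φ2 := funext fun y => (h1 y).deriv
      have e2 : deriv φ2 = fun y => c * ((μ - V y) * φ1 y + V1 y * φ y - g y) :=
        funext fun y => (h2 y).deriv
      have hn : ((n : ℕ∞) : WithTop ℕ∞) ≤ ((⊤ : ℕ∞) : WithTop ℕ∞) := by exact_mod_cast le_top
      have v : ContDiff ℝ n (fun y => (V y : ℂ)) := Complex.ofRealCLM.contDiff.comp (hV.of_le hn)
      have v1 : ContDiff ℝ n (fun y => (V1 y : ℂ)) := Complex.ofRealCLM.contDiff.comp (hV1.of_le hn)
      have hg' : ContDiff ℝ n g := hg.of_le hn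
      have hω : ((n : ℕ) : WithTop ℕ∞) ≠ ⊤ := by exact WithTop.natCast_ne_top n
      push_cast
      refine ⟨contDiff_succ_iff_deriv.2 ⟨fun y => (h0 y).differentiableAt, fun h => absurd h hω, ?_⟩,
        contDiff_succ_iff_deriv.2 ⟨fun y => (h1 y).differentiableAt, fun h => absurd h hω, ?_⟩,
        contDiff_succ_iff_deriv.2 ⟨fun y => (h2 y).differentiableAt, fun h => absurd h hω, ?_⟩⟩
      · rw [e0]; exact i1
      · rw [e1]; exact i2
      · rw [e2]; fun_prop
  exact contDiff_infty.2 fun n => (key n).1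
end

lemma chain_of_contDiff {ψ : ℝ → ℂ} (h : ContDiff ℝ (⊤ : ℕ∞) ψ) :
    Chain ψ (deriv ψ) (iteratedDeriv 2 ψ) (iteratedDeriv 3 ψ) := by
  have hD : ∀ n : ℕ, ∀ y, HasDerivAt (iteratedDeriv n ψ) (iteratedDeriv (n+1) ψ y) y := by
    intro n y
    rw [iteratedDeriv_succ]
    have : Differentiable ℝ (iteratedDeriv n ψ) :=
      h.differentiable_iteratedDeriv n (by exact_mod_cast WithTop.coe_lt_top _)
    exact (this y).hasDerivAt
  refine ⟨fun y => ?_, fun y => ?_, hD 2,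
    continuous_iff_continuousAt.2 fun y => (hD 3 y).continuousAt⟩
  · have := hD 0 y
    simpa [iteratedDeriv_zero, iteratedDeriv_one] using this
  · have := hD 1 y
    rwa [iteratedDeriv_one] at this

/-- Corollary (well-posedness and analyticity for the unit-forced resolvent problem). -/
theorem unit_forced_resolvent (U ω : ℝ → ℝ)
    (hU : AdmissibleShearFlow U) (hω : WeightFn ω) (hdec : WeightedDecay U ω)
    (η : ℝ) (hη : 0 < η) :
    ∃ K : ℝ, 0 < K ∧ ∀ k : ℕ, K ≤ (k : ℝ) →
      ∃ sol : ℂ → ℝ → ℂ,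
        (∀ μ : ℂ, η ≤ μ.im →
          IsBLSolution U μ (k : ℝ) (sol μ) ∧
          ∀ ψ : ℝ → ℂ, IsBLSolution U μ (k : ℝ) ψ → EqOn ψ (sol μ) (Ici 0)) ∧
        ∀ y : ℝ, AnalyticOn ℂ (fun μ => sol μ y) {μ : ℂ | η ≤ μ.im} := by
  obtain ⟨M, M3, B, B2, B3, -, -, -, hB2, hB3, hP⟩ := exists_prof hU hω hdec
  have hη' : 0 < η / 2 := by linarith
  refine ⟨max 1 (Kthr M M3 (η / 2)), lt_max_of_lt_left one_pos, fun k hk => ?_⟩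
  have hk1 : (1:ℝ) ≤ k := (le_max_left _ _).trans hk
  have hkK : Kthr M M3 (η / 2) ≤ k := (le_max_right _ _).trans hk
  have hk0 : (0:ℝ) < k := by linarith
  have hkC : ((k:ℝ):ℂ) ≠ 0 := by exact_mod_cast hk0.ne'
  obtain ⟨s, s1, s2, h0, h1, h2, hs0, hs1, hst, hsd⟩ := family hP hB2 hB3 hη' hk1 hkK
  have hIk : Complex.I / ((k:ℝ):ℂ) * (-(Complex.I * ((k:ℝ):ℂ))) = 1 := by
    field_simp; simp
  have hsmooth1 : ContDiff ℝ (⊤ : ℕ∞) (deriv U) := by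
    exact (contDiff_infty_iff_deriv.1 hU.smooth).2
  have hsol : ∀ μ : ℂ, η ≤ μ.im → IsBLSolution U μ (k : ℝ) (s μ) := by
    intro μ hμ
    have e0 : deriv (s μ) = s1 μ := funext fun y => (h0 μ y).deriv
    have e1 : deriv (s1 μ) = s2 μ := funext fun y => (h1 μ y).deriv
    have e3 : ∀ y, iteratedDeriv 3 (s μ) y = -(Complex.I * ((k:ℝ):ℂ)) * ((μ - U y) * s1 μ y
        + ((deriv U y : ℝ) : ℂ) * s μ y - ((1 - U y + y * deriv U y : ℝ) : ℂ)) := by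
      intro y
      rw [iteratedDeriv_succ, iteratedDeriv_succ, iteratedDeriv_one, e0, e1]
      exact (h2 μ y).deriv
    refine ⟨?_, ?_, hs0 μ, ?_, ?_⟩
    · have hs := hU.smooth
      refine contDiff_of_chain hs hsmooth1
        (g := fun y => ((1 - U y + y * deriv U y : ℝ) : ℂ)) ?_ (h0 μ) (h1 μ) (h2 μ)
      exact Complex.ofRealCLM.contDiff.comp
        ((contDiff_const.sub hs).add (contDiff_id.mul hsmooth1))
    · intro y _
      rw [e0, e3, srcF]
      linear_combination (-((μ - U y) * s1 μ y
        + ((deriv U y : ℝ) : ℂ) * s μ y - ((1 - U y + y * deriv U y : ℝ) : ℂ))) * hIk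
    · rw [e0]; exact hs1 μ
    · rw [e0]; exact hst μ (by linarith)
  refine ⟨s, fun μ hμ => ⟨hsol μ hμ, ?_⟩, fun y => ?_⟩
  · intro ψ hψ y hy
    obtain ⟨a1, a2, a3, a4, a5⟩ := hψ
    obtain ⟨b1, b2, b3, b4, b5⟩ := hsol μ hμ
    have hd := (chain_of_contDiff a1).comb (chain_of_contDiff b1) (-1)
    have := uniq_zero (μ := μ) hP hη' hk0 (by linarith) hkK hd (by simp [a3, b3])
      (by simp [a4, b4])
      (by
        have := a5.sub b5
        rw [sub_zero] at this
        refine this.congr fun y => ?_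
        ring) (fun y hy => by linear_combination a2 y hy - b2 y hy) hy
    linear_combination this
  · have hop : IsOpen {μ : ℂ | η / 2 < μ.im} := isOpen_lt continuous_const Complex.continuous_im
    refine ((hsd y).analyticOnNhd hop).analyticOn.mono ?_
    intro μ hμ
    have : η ≤ μ.im := hμ
    show η / 2 < μ.im
    linarith

end
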